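/- Let m ≥ 1, N > 2m, let Ψ satisfy condition (K), and let p, q > 0 with p + q ≥ 2. Assume moreover limsup_{r→∞} r^{2N−(N−2m)(p+q)} Ψ(r) > 0. If u ∈ C^{2m}(ℝ^N) is a non-negative solution of (−Δ)^m u ≥ (Ψ(|·|) * u^p) u^q in ℝ^N, then u ≡ 0. -/

import Mathlib

open MeasureTheory Filter Metric

/-- The Laplacian of `u : ℝ^N → ℝ`, defined via the second iterated Fréchet derivative. -/
noncomputable def lap {N : ℕ} (u : EuclideanSpace ℝ (Fin N) → ℝ) :
    EuclideanSpace ℝ (Fin N) → ℝ :=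
  fun x => ∑ i : Fin N,
    iteratedFDeriv ℝ 2 u x ![EuclideanSpace.single i 1, EuclideanSpace.single i 1]

/-- `negLapPow m u = (-Δ)^m u`, the `m`-fold iterate of the negative Laplacian. -/
noncomputable def negLapPow {N : ℕ} (m : ℕ) (u : EuclideanSpace ℝ (Fin N) → ℝ) :
    EuclideanSpace ℝ (Fin N) → ℝ :=
  (fun v => fun x => -(lap v x))^[m] u

/-- Condition (K) on the kernel `Ψ`. -/
structure CondK (N : ℕ) (Ψ : ℝ → ℝ) : Prop where
  pos : ∀ r : ℝ, 0 < r → 0 < Ψ r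
  cont : ContinuousOn (fun x : EuclideanSpace ℝ (Fin N) => Ψ ‖x‖)
    {(0 : EuclideanSpace ℝ (Fin N))}ᶜ
  locInt : LocallyIntegrable (fun x : EuclideanSpace ℝ (Fin N) => Ψ ‖x‖) volume
  anti : AntitoneOn Ψ (Set.Ioi (0 : ℝ))
  tendsto : Tendsto (fun r : ℝ => r ^ N * Ψ r) atTop atTop

local notation "𝔼" N => EuclideanSpace ℝ (Fin N)

section Green

variable {N : ℕ}

lemma lap_eq_sum_fderiv (w : (𝔼 N) → ℝ) (x : 𝔼 N) (hw : ContDiff ℝ 2 w) :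
    lap w x = ∑ i : Fin N, fderiv ℝ
      (fun y => fderiv ℝ w y (EuclideanSpace.single i 1)) x (EuclideanSpace.single i 1) := by
  unfold lap
  refine Finset.sum_congr rfl fun i _ => ?_
  rw [iteratedFDeriv_two_apply]
  have h1 : DifferentiableAt ℝ (fderiv ℝ w) x :=
    ((hw.fderiv_right (m := 1) (by norm_num)).differentiable (by norm_num)) x
  rw [fderiv_clm_apply h1 (by fun_prop)]
  simp

lemma contDiff_lap {n : ℕ} {w : (𝔼 N) → ℝ} (hw : ContDiff ℝ (n + 2 : ℕ) w) :
    ContDiff ℝ n (lap w) := by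
  have h2 : ContDiff ℝ 2 w := hw.of_le (by norm_cast; omega)
  have : lap w = fun x => ∑ i : Fin N, fderiv ℝ
      (fun y => fderiv ℝ w y (EuclideanSpace.single i 1)) x (EuclideanSpace.single i 1) := by
    funext x; exact lap_eq_sum_fderiv w x h2
  rw [this]
  refine ContDiff.sum fun i _ => ?_
  have h3 : ContDiff ℝ (n + 1 : ℕ) (fderiv ℝ w) := hw.fderiv_right (by norm_cast)
  have h4 : ContDiff ℝ (n + 1 : ℕ) (fun y => fderiv ℝ w y (EuclideanSpace.single i 1)) :=
    h3.clm_apply contDiff_const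
  exact (h4.fderiv_right (m := n) (by norm_cast)).clm_apply contDiff_const

lemma negLapPow_succ (m : ℕ) (u : (𝔼 N) → ℝ) :
    negLapPow (m + 1) u = fun x => -(lap (negLapPow m u) x) := by
  unfold negLapPow
  rw [Function.iterate_succ_apply']

lemma contDiff_negLapPow (m n : ℕ) {u : (𝔼 N) → ℝ} (hu : ContDiff ℝ (n + 2 * m : ℕ) u) :
    ContDiff ℝ n (negLapPow m u) := by
  induction m generalizing n with
  | zero => simpa [negLapPow] using hu
  | succ m ih =>
    rw [negLapPow_succ]
    exact (contDiff_lap (ih (n + 2) (by convert hu using 2; ring))).neg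

/-- A radial profile evaluated at `c |x|²` is compactly supported if the profile vanishes far
out. -/
lemma integrable_mul_radial {w : (𝔼 N) → ℝ} (hw : Continuous w) {f : (𝔼 N) → ℝ}
    (hf : Continuous f) {c B : ℝ} (hc : 0 < c) (hfB : ∀ x, B ≤ c * ‖x‖ ^ 2 → f x = 0) :
    Integrable (fun x => w x * f x) := by
  refine (hw.mul hf).integrable_of_hasCompactSupport ?_
  refine HasCompactSupport.intro (isCompact_closedBall (0 : 𝔼 N) (|B| / c + 1)) fun x hx => ?_
  have hx' : |B| / c + 1 < ‖x‖ := by simpa using hx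
  have h0 : 0 ≤ |B| / c := by positivity
  have h1 : |B| / c ≤ ‖x‖ ^ 2 := by nlinarith
  have h2 : |B| ≤ c * ‖x‖ ^ 2 := by
    rw [div_le_iff₀ hc] at h1; linarith
  simp [hfB x ((le_abs_self B).trans h2)]

lemma integral_lap_mul_radial {w : (𝔼 N) → ℝ} (hw : ContDiff ℝ 2 w) {f f₁ f₂ : ℝ → ℝ}
    (hf : ∀ t, 0 ≤ t → HasDerivAt f (f₁ t) t) (hf₁ : ∀ t, 0 ≤ t → HasDerivAt f₁ (f₂ t) t)
    (hf₂ : ContinuousOn f₂ (Set.Ici 0)) {B c : ℝ} (hc : 0 < c)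
    (hB : ∀ t, B ≤ t → f t = 0) (hB₁ : ∀ t, B ≤ t → f₁ t = 0) (hB₂ : ∀ t, B ≤ t → f₂ t = 0) :
    ∫ x, lap w x * f (c * ‖x‖ ^ 2) =
      ∫ x, w x * (c * (4 * (c * ‖x‖ ^ 2) * f₂ (c * ‖x‖ ^ 2) + 2 * N * f₁ (c * ‖x‖ ^ 2))) := by
  have hnn : ∀ x : 𝔼 N, 0 ≤ c * ‖x‖ ^ 2 := fun x => by positivity
  have cq : Continuous fun x : 𝔼 N => c * ‖x‖ ^ 2 := by fun_prop
  have cf : Continuous fun x : 𝔼 N => f (c * ‖x‖ ^ 2) :=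
    continuous_iff_continuousAt.2 fun x =>
      ContinuousAt.comp (f := fun x : 𝔼 N => c * ‖x‖ ^ 2) (hf _ (hnn x)).continuousAt
        cq.continuousAt
  have cf₁ : Continuous fun x : 𝔼 N => f₁ (c * ‖x‖ ^ 2) :=
    continuous_iff_continuousAt.2 fun x =>
      ContinuousAt.comp (f := fun x : 𝔼 N => c * ‖x‖ ^ 2) (hf₁ _ (hnn x)).continuousAt
        cq.continuousAt
  have cf₂ : Continuous fun x : 𝔼 N => f₂ (c * ‖x‖ ^ 2) :=
    hf₂.comp_continuous cq hnn
  have hq : ∀ x : 𝔼 N, HasFDerivAt (fun x : 𝔼 N => c * ‖x‖ ^ 2)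
      (c • (2 • innerSL ℝ x)) x := fun x =>
    ((hasStrictFDerivAt_norm_sq x).hasFDerivAt).const_mul c
  have hin : ∀ (x : 𝔼 N) (i : Fin N), innerSL ℝ x (EuclideanSpace.single i 1) = x i := by
    intro x i
    simp [EuclideanSpace.inner_single_right]
  have ccoord : ∀ i : Fin N, Continuous fun x : 𝔼 N => x i := fun i => by fun_prop
  have hfi : ∀ (i : Fin N) (x : 𝔼 N), HasLineDerivAt ℝ (fun x : 𝔼 N => f (c * ‖x‖ ^ 2))
      (2 * c * x i * f₁ (c * ‖x‖ ^ 2)) x (EuclideanSpace.single i 1) := by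
    intro i x
    have := ((hf _ (hnn x)).comp_hasFDerivAt x (hq x)).hasLineDerivAt (EuclideanSpace.single i 1)
    have e : (f₁ (c * ‖x‖ ^ 2) • (c • (2 • innerSL ℝ x))) (EuclideanSpace.single i 1) =
        2 * c * x i * f₁ (c * ‖x‖ ^ 2) := by
      simp [hin]; ring
    rw [e] at this
    exact this
  have hfii : ∀ (i : Fin N) (x : 𝔼 N),
      HasLineDerivAt ℝ (fun x : 𝔼 N => 2 * c * x i * f₁ (c * ‖x‖ ^ 2))
      (2 * c * f₁ (c * ‖x‖ ^ 2) + 4 * c ^ 2 * (x i) ^ 2 * f₂ (c * ‖x‖ ^ 2)) x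
      (EuclideanSpace.single i 1) := by
    intro i x
    have h1 := ((hf₁ _ (hnn x)).comp_hasFDerivAt x (hq x))
    have h2 : HasFDerivAt (fun x : 𝔼 N => x i) (EuclideanSpace.proj i : (𝔼 N) →L[ℝ] ℝ) x :=
      (EuclideanSpace.proj i : (𝔼 N) →L[ℝ] ℝ).hasFDerivAt
    have := ((h2.const_mul (2 * c)).mul h1).hasLineDerivAt (EuclideanSpace.single i 1)
    have e : ((2 * c * x i) • (f₂ (c * ‖x‖ ^ 2) • (c • (2 • innerSL ℝ x))) +
        f₁ (c * ‖x‖ ^ 2) • ((2 * c) • (EuclideanSpace.proj i : (𝔼 N) →L[ℝ] ℝ)))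
        (EuclideanSpace.single i 1) =
        2 * c * f₁ (c * ‖x‖ ^ 2) + 4 * c ^ 2 * (x i) ^ 2 * f₂ (c * ‖x‖ ^ 2) := by
      simp [hin]; ring
    rw [← e]
    exact this
  have hsum : ∀ x : 𝔼 N, ∑ i : Fin N, (x i) ^ 2 = ‖x‖ ^ 2 := fun x => by
    rw [EuclideanSpace.norm_sq_eq]; simp
  have hd1 : ∀ i : Fin N, ContDiff ℝ 1 (fun y => fderiv ℝ w y (EuclideanSpace.single i 1)) :=
    fun i => (hw.fderiv_right (m := 1) (by norm_num)).clm_apply contDiff_const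
  have hd2 : ∀ i : Fin N, Continuous fun x => fderiv ℝ
      (fun y => fderiv ℝ w y (EuclideanSpace.single i 1)) x (EuclideanSpace.single i 1) :=
    fun i => ((hd1 i).continuous_fderiv (by norm_num)).clm_apply continuous_const
  have key : ∀ i : Fin N,
      ∫ x, fderiv ℝ (fun y => fderiv ℝ w y (EuclideanSpace.single i 1)) x
        (EuclideanSpace.single i 1) * f (c * ‖x‖ ^ 2) =
      ∫ x, w x * (2 * c * f₁ (c * ‖x‖ ^ 2) + 4 * c ^ 2 * (x i) ^ 2 * f₂ (c * ‖x‖ ^ 2)) := by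
    intro i
    have I0 : ∀ v : (𝔼 N) → ℝ, Continuous v → Integrable fun x => v x * f (c * ‖x‖ ^ 2) :=
      fun v hv => integrable_mul_radial (B := B) hv cf hc fun x hx => hB _ hx
    have I1 : ∀ v : (𝔼 N) → ℝ, Continuous v →
        Integrable fun x => v x * (2 * c * x i * f₁ (c * ‖x‖ ^ 2)) :=
      fun v hv => integrable_mul_radial (B := B) hv ((continuous_const.mul (ccoord i)).mul cf₁) hc
        fun x hx => by simp [hB₁ _ hx]
    have I2 : ∀ v : (𝔼 N) → ℝ, Continuous v → Integrable fun x => v x *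
        (2 * c * f₁ (c * ‖x‖ ^ 2) + 4 * c ^ 2 * (x i) ^ 2 * f₂ (c * ‖x‖ ^ 2)) :=
      fun v hv => integrable_mul_radial (B := B) hv ((continuous_const.mul cf₁).add
        ((continuous_const.mul ((ccoord i).pow 2)).mul cf₂)) hc
        fun x hx => by simp [hB₁ _ hx, hB₂ _ hx]
    have e1 := integral_bilinear_hasLineDerivAt_right_eq_neg_left_of_integrable
      (μ := (volume : Measure (𝔼 N)))
      (B := ContinuousLinearMap.mul ℝ ℝ) (v := EuclideanSpace.single i 1)
      (f := fun y => fderiv ℝ w y (EuclideanSpace.single i 1))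
      (f' := fun x => fderiv ℝ
        (fun y => fderiv ℝ w y (EuclideanSpace.single i 1)) x (EuclideanSpace.single i 1))
      (g := fun x => f (c * ‖x‖ ^ 2)) (g' := fun x => 2 * c * x i * f₁ (c * ‖x‖ ^ 2))
      (I0 _ (hd2 i)) (I1 _ (hd1 i).continuous) (I0 _ (hd1 i).continuous)
      (fun x _ => (((hd1 i).differentiable (by norm_num)) x).hasFDerivAt.hasLineDerivAt _)
      (fun x _ => hfi i x)
    have e2 := integral_bilinear_hasLineDerivAt_right_eq_neg_left_of_integrable
      (μ := (volume : Measure (𝔼 N)))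
      (B := ContinuousLinearMap.mul ℝ ℝ) (v := EuclideanSpace.single i 1)
      (f := w)
      (f' := fun y => fderiv ℝ w y (EuclideanSpace.single i 1))
      (g := fun x => 2 * c * x i * f₁ (c * ‖x‖ ^ 2))
      (g' := fun x => 2 * c * f₁ (c * ‖x‖ ^ 2) + 4 * c ^ 2 * (x i) ^ 2 * f₂ (c * ‖x‖ ^ 2))
      (I1 _ (hd1 i).continuous) (I2 _ hw.continuous) (I1 _ hw.continuous)
      (fun x _ => ((hw.differentiable (by norm_num)) x).hasFDerivAt.hasLineDerivAt _)
      (fun x _ => hfii i x)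
    simp only [ContinuousLinearMap.mul_apply'] at e1 e2
    linarith
  have L1 : ∀ x, lap w x * f (c * ‖x‖ ^ 2) = ∑ i : Fin N, fderiv ℝ
      (fun y => fderiv ℝ w y (EuclideanSpace.single i 1)) x (EuclideanSpace.single i 1)
        * f (c * ‖x‖ ^ 2) := fun x => by
    rw [lap_eq_sum_fderiv w x hw, Finset.sum_mul]
  have L2 : ∀ x : 𝔼 N,
      w x * (c * (4 * (c * ‖x‖ ^ 2) * f₂ (c * ‖x‖ ^ 2) + 2 * N * f₁ (c * ‖x‖ ^ 2))) =
      ∑ i : Fin N, w x * (2 * c * f₁ (c * ‖x‖ ^ 2) + 4 * c ^ 2 * (x i) ^ 2 * f₂ (c * ‖x‖ ^ 2)) :=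
    fun x => by
      rw [← Finset.mul_sum, Finset.sum_add_distrib, Finset.sum_const, ← Finset.sum_mul,
        ← Finset.mul_sum, hsum, Finset.card_univ, Fintype.card_fin, nsmul_eq_mul]
      ring
  simp_rw [L1, L2]
  rw [integral_finsetSum, integral_finsetSum]
  · exact Finset.sum_congr rfl fun i _ => key i
  · intro i _
    exact integrable_mul_radial (B := B) hw.continuous ((continuous_const.mul cf₁).add
        ((continuous_const.mul ((ccoord i).pow 2)).mul cf₂)) hc
        fun x hx => by simp [hB₁ _ hx, hB₂ _ hx]
  · intro i _
    exact integrable_mul_radial (B := B) (hd2 i) cf hc fun x hx => hB _ hx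

end Green

section Profiles

/-- The cutoff factor `(1 - (κ(1+t))^L)₊`, supported where `κ(1+t) ≤ 1`. -/
noncomputable def cutoff (L : ℕ) (κ t : ℝ) : ℝ := max 0 (1 - (κ * (1 + t)) ^ L)

/-- The profile `κ^{Li} v^{A-Li} w^k`, where `v = (1+t)⁻¹` and `w` is the cutoff factor. -/
noncomputable def profile (L : ℕ) (A : ℝ) (i k : ℕ) (κ t : ℝ) : ℝ :=
  κ ^ (L * i) * (1 + t) ^ (L * i - A) * cutoff L κ t ^ k

lemma hasDerivAt_max_zero_pow (k : ℕ) (y : ℝ) :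
    HasDerivAt (fun y : ℝ => max 0 y ^ (k + 2)) ((k + 2) * max 0 y ^ (k + 1)) y := by
  rcases lt_trichotomy y 0 with h | h | h
  · have e : (fun y : ℝ => max 0 y ^ (k + 2)) =ᶠ[nhds y] fun _ => 0 := by
      filter_upwards [Iio_mem_nhds h] with z hz
      simp [max_eq_left (le_of_lt (Set.mem_Iio.1 hz))]
    rw [max_eq_left h.le]
    simpa using (hasDerivAt_const y (0 : ℝ)).congr_of_eventuallyEq e
  · subst h
    rw [hasDerivAt_iff_isLittleO_nhds_zero]
    simp only [zero_add, max_self, ne_eq, Nat.add_eq_zero_iff, one_ne_zero, and_false,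
      not_false_eq_true, zero_pow, OfNat.ofNat_ne_zero, mul_zero, smul_zero, sub_zero]
    have h1 : (fun h : ℝ => max 0 h ^ (k + 2)) =O[nhds 0] fun h : ℝ => h ^ (k + 2) := by
      refine Asymptotics.IsBigO.of_bound 1 (Eventually.of_forall fun z => ?_)
      rw [norm_pow, norm_pow, one_mul]
      refine pow_le_pow_left₀ (norm_nonneg _) ?_ _
      rw [Real.norm_eq_abs, Real.norm_eq_abs, abs_of_nonneg (le_max_left _ _)]
      exact max_le (abs_nonneg _) (le_abs_self _)
    refine h1.trans_isLittleO ?_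
    have := Asymptotics.isLittleO_pow_pow (𝕜 := ℝ) (m := 1) (n := k + 2) (by omega)
    simpa using this
  · have e : (fun y : ℝ => max 0 y ^ (k + 2)) =ᶠ[nhds y] fun y => y ^ (k + 2) := by
      filter_upwards [Ioi_mem_nhds h] with z hz
      simp [max_eq_right (le_of_lt (Set.mem_Ioi.1 hz))]
    rw [max_eq_right h.le]
    have := (hasDerivAt_pow (k + 2) y).congr_of_eventuallyEq e
    simpa using this

lemma hasDerivAt_cutoff_pow (L : ℕ) (κ : ℝ) (k : ℕ) (t : ℝ) :
    HasDerivAt (fun t => cutoff L κ t ^ (k + 2))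
      (-((k + 2) * L * κ ^ L * (1 + t) ^ (L - 1) * cutoff L κ t ^ (k + 1))) t := by
  have h1 : HasDerivAt (fun t : ℝ => 1 - (κ * (1 + t)) ^ L)
      (-(L * (κ * (1 + t)) ^ (L - 1) * κ)) t := by
    have := ((((hasDerivAt_id t).const_add 1).const_mul κ).pow L).const_sub 1
    simpa using this
  have := (hasDerivAt_max_zero_pow k (1 - (κ * (1 + t)) ^ L)).comp t h1
  refine this.congr_deriv ?_
  unfold cutoff
  rcases Nat.eq_zero_or_pos L with h | h
  · subst h; simp
  · obtain ⟨l, rfl⟩ : ∃ l, L = l + 1 := ⟨L - 1, by omega⟩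
    simp only [Nat.add_sub_cancel]
    simp only [mul_pow]
    ring

lemma hasDerivAt_profile (L : ℕ) (hL : 1 ≤ L) (A : ℝ) (i k : ℕ) (κ : ℝ) {t : ℝ} (ht : -1 < t) :
    HasDerivAt (profile L A i (k + 2) κ)
      (-((A - L * i) * profile L (A + 1) i (k + 2) κ t) -
        (k + 2) * L * profile L (A + 1) (i + 1) (k + 1) κ t) t := by
  have ht' : 0 < 1 + t := by linarith
  have h1 : HasDerivAt (fun t : ℝ => (1 + t) ^ (L * i - A : ℝ))
      ((L * i - A) * (1 + t) ^ (L * i - A - 1 : ℝ)) t := by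
    have := ((hasDerivAt_id t).const_add 1).rpow_const (p := (L * i - A : ℝ)) (Or.inl ht'.ne')
    simpa [mul_comm] using this
  have := (h1.const_mul (κ ^ (L * i))).mul (hasDerivAt_cutoff_pow L κ k t)
  refine (this.congr_deriv ?_)
  unfold profile
  have e1 : (L * i - (A + 1) : ℝ) = L * i - A - 1 := by ring
  have e2 : (1 + t) ^ ((L : ℝ) * ((i + 1 : ℕ) : ℝ) - (A + 1)) =
      (1 + t) ^ (L * i - A : ℝ) * (1 + t) ^ (L - 1) := by
    rw [← Real.rpow_natCast, ← Real.rpow_add ht']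
    congr 1
    rw [Nat.cast_sub hL]
    push_cast; ring
  rw [e1, e2]
  rw [mul_add L i 1, pow_add, mul_one]
  ring

lemma mul_profile_add_two (L : ℕ) (A : ℝ) (i k : ℕ) (κ : ℝ) {t : ℝ} (ht : 0 ≤ t) :
    t * profile L (A + 2) i k κ t = profile L (A + 1) i k κ t - profile L (A + 2) i k κ t := by
  have ht' : 0 < 1 + t := by linarith
  unfold profile
  have e : (1 + t) ^ (L * i - (A + 1) : ℝ) = (1 + t) ^ (L * i - (A + 2) : ℝ) * (1 + t) := by
    rw [← Real.rpow_add_one ht'.ne']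
    congr 1; ring
  rw [e]; ring

lemma profile_eq_zero (L : ℕ) (A : ℝ) (i k : ℕ) {κ t : ℝ} (hκ : 0 < κ) (hk : 1 ≤ k)
    (ht : 1 / κ - 1 ≤ t) : profile L A i k κ t = 0 := by
  have h1 : 1 ≤ κ * (1 + t) := by
    have : 1 / κ ≤ 1 + t := by linarith
    rw [div_le_iff₀ hκ] at this; linarith
  have : cutoff L κ t = 0 := by
    unfold cutoff
    exact max_eq_left (by linarith [one_le_pow₀ (n := L) h1])
  unfold profile
  rw [this, zero_pow (by omega), mul_zero]

lemma continuousOn_profile (L : ℕ) (A : ℝ) (i k : ℕ) (κ : ℝ) :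
    ContinuousOn (profile L A i k κ) (Set.Ici 0) := by
  unfold profile cutoff
  refine ContinuousOn.mul (ContinuousOn.mul continuousOn_const ?_) (by fun_prop)
  refine ContinuousOn.rpow_const (by fun_prop) fun x hx => Or.inl ?_
  have : (0 : ℝ) ≤ x := hx
  positivity

/-- `iterProfile N L m A i k κ` is the radial profile of `(-Δ)^m` applied to the radial function
with profile `profile L A i k κ`. -/
noncomputable def iterProfile (N L : ℕ) : ℕ → ℝ → ℕ → ℕ → ℝ → ℝ → ℝ
  | 0, A, i, k, κ, t => profile L A i k κ t
  | m + 1, A, i, k, κ, t =>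
    (2 * N * (A - L * i) - 4 * ((A - L * i) * (A - L * i + 1))) *
        iterProfile N L m (A + 1) i k κ t +
      4 * ((A - L * i) * (A - L * i + 1)) * iterProfile N L m (A + 2) i k κ t +
      (2 * N * (k * L) - 4 * (k * L * (2 * (A - L * i) + 1 - L))) *
        iterProfile N L m (A + 1) (i + 1) (k - 1) κ t +
      4 * (k * L * (2 * (A - L * i) + 1 - L)) * iterProfile N L m (A + 2) (i + 1) (k - 1) κ t -
      4 * (k * (k - 1) * L ^ 2) * iterProfile N L m (A + 1) (i + 2) (k - 2) κ t +
      4 * (k * (k - 1) * L ^ 2) * iterProfile N L m (A + 2) (i + 2) (k - 2) κ t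

/-- The polynomial in `v = (1+t)⁻¹` describing `(-Δ)^m v^A` as `v^{A+m}` times a polynomial. -/
noncomputable def mainCoeff (N : ℕ) : ℕ → ℝ → ℝ → ℝ
  | 0, _, _ => 1
  | m + 1, A, v => (2 * N * A - 4 * (A * (A + 1))) * mainCoeff N m (A + 1) v +
      4 * (A * (A + 1)) * (v * mainCoeff N m (A + 2) v)

variable {N : ℕ}

lemma continuous_profile_radial (L : ℕ) (A : ℝ) (i k : ℕ) (κ : ℝ) {c : ℝ} (hc : 0 < c) :
    Continuous fun x : 𝔼 N => profile L A i k κ (c * ‖x‖ ^ 2) :=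
  (continuousOn_profile L A i k κ).comp_continuous (by fun_prop)
    fun x => Set.mem_Ici.2 (by positivity)

lemma integrable_mul_iterProfile (L m : ℕ) (A : ℝ) (i k : ℕ) (hk : 2 * m + 1 ≤ k) {κ : ℝ}
    (hκ : 0 < κ) {c : ℝ} (hc : 0 < c) {u : (𝔼 N) → ℝ} (hu : Continuous u) :
    Integrable fun x => u x * iterProfile N L m A i k κ (c * ‖x‖ ^ 2) := by
  induction m generalizing A i k with
  | zero =>
    exact integrable_mul_radial (B := 1 / κ - 1) hu (continuous_profile_radial L A i k κ hc) hc
      fun x hx => profile_eq_zero L A i k hκ (by omega) hx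
  | succ m ih =>
    have h1 := ih (A + 1) i k (by omega)
    have h2 := ih (A + 2) i k (by omega)
    have h3 := ih (A + 1) (i + 1) (k - 1) (by omega)
    have h4 := ih (A + 2) (i + 1) (k - 1) (by omega)
    have h5 := ih (A + 1) (i + 2) (k - 2) (by omega)
    have h6 := ih (A + 2) (i + 2) (k - 2) (by omega)
    have := (((((h1.const_mul (2 * N * (A - L * i) - 4 * ((A - L * i) * (A - L * i + 1)))).add
      (h2.const_mul (4 * ((A - L * i) * (A - L * i + 1))))).add
      (h3.const_mul (2 * N * (k * L) - 4 * (k * L * (2 * (A - L * i) + 1 - L))))).add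
      (h4.const_mul (4 * (k * L * (2 * (A - L * i) + 1 - L))))).sub
      (h5.const_mul (4 * (k * (k - 1) * L ^ 2)))).add
      (h6.const_mul (4 * (k * (k - 1) * L ^ 2)))
    refine this.congr (Eventually.of_forall fun x => ?_)
    simp only [iterProfile, Pi.add_apply, Pi.sub_apply]
    ring

lemma integral_neg_lap_mul_profile {L : ℕ} (hL : 1 ≤ L) (A : ℝ) (i k : ℕ) (hk : 3 ≤ k) {κ : ℝ}
    (hκ : 0 < κ) {c : ℝ} (hc : 0 < c) {w : (𝔼 N) → ℝ} (hw : ContDiff ℝ 2 w) :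
    ∫ x, -(lap w x) * profile L A i k κ (c * ‖x‖ ^ 2) =
      c * ∫ x, w x * iterProfile N L 1 A i k κ (c * ‖x‖ ^ 2) := by
  obtain ⟨k, rfl⟩ : ∃ l, k = l + 3 := ⟨k - 3, by omega⟩
  have hd : ∀ (B : ℝ) (j l : ℕ) (t : ℝ), 0 ≤ t → HasDerivAt (profile L B j (l + 2) κ)
      (-((B - L * j) * profile L (B + 1) j (l + 2) κ t) -
        (l + 2) * L * profile L (B + 1) (j + 1) (l + 1) κ t) t :=
    fun B j l t ht => hasDerivAt_profile L hL B j l κ (by linarith)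
  have h2 : ∀ t, 0 ≤ t → HasDerivAt (fun t => -((A - L * i) * profile L (A + 1) i (k + 3) κ t) -
        (k + 3) * L * profile L (A + 1) (i + 1) (k + 2) κ t)
      ((A - L * i) * (A - L * i + 1) * profile L (A + 2) i (k + 3) κ t +
        (k + 3) * L * (2 * (A - L * i) + 1 - L) * profile L (A + 2) (i + 1) (k + 2) κ t +
        (k + 3) * (k + 2) * L ^ 2 * profile L (A + 2) (i + 2) (k + 1) κ t) t := by
    intro t ht
    have := (((hd (A + 1) i (k + 1) t ht).const_mul (A - L * i)).neg).sub
      ((hd (A + 1) (i + 1) k t ht).const_mul ((k + 3) * L : ℝ))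
    refine this.congr_deriv ?_
    rw [show A + 1 + 1 = A + 2 by ring]
    push_cast
    ring
  have hz : ∀ (B : ℝ) (j l : ℕ) (t : ℝ), 1 / κ - 1 ≤ t → profile L B j (l + 1) κ t = 0 :=
    fun B j l t ht => profile_eq_zero L B j (l + 1) hκ (by omega) ht
  have key := integral_lap_mul_radial hw (f := profile L A i (k + 3) κ)
    (fun t ht => (hd A i (k + 1) t ht).congr_deriv (by push_cast; ring)) h2
    (((continuousOn_const.mul (continuousOn_profile _ _ _ _ _)).add
      (continuousOn_const.mul (continuousOn_profile _ _ _ _ _))).add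
      (continuousOn_const.mul (continuousOn_profile _ _ _ _ _))) hc
    (B := 1 / κ - 1) (fun t ht => hz A i (k + 2) t ht)
    (fun t ht => by rw [hz _ i (k + 2) t ht, hz _ (i + 1) (k + 1) t ht]; ring)
    (fun t ht => by
      rw [hz _ i (k + 2) t ht, hz _ (i + 1) (k + 1) t ht, hz _ (i + 2) k t ht]; ring)
  simp_rw [neg_mul]
  rw [integral_neg, key, ← integral_neg, ← integral_const_mul]
  refine integral_congr_ae (Eventually.of_forall fun x => ?_)
  have hx : 0 ≤ c * ‖x‖ ^ 2 := by positivity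
  have m1 := mul_profile_add_two L A i (k + 3) κ hx
  have m2 := mul_profile_add_two L A (i + 1) (k + 2) κ hx
  have m3 := mul_profile_add_two L A (i + 2) (k + 1) κ hx
  simp only [iterProfile]
  rw [show k + 3 - 1 = k + 2 by omega, show k + 3 - 2 = k + 1 by omega]
  push_cast
  linear_combination (-4 * w x * c * ((A - L * i) * (A - L * i + 1))) * m1 +
    (-4 * w x * c * ((k + 3) * L * (2 * (A - L * i) + 1 - L))) * m2 +
    (-4 * w x * c * ((k + 3) * (k + 2) * L ^ 2)) * m3

lemma integral_six {f₁ f₂ f₃ f₄ f₅ f₆ : (𝔼 N) → ℝ} (h₁ : Integrable f₁) (h₂ : Integrable f₂)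
    (h₃ : Integrable f₃) (h₄ : Integrable f₄) (h₅ : Integrable f₅) (h₆ : Integrable f₆) :
    ∫ x, (f₁ x + f₂ x + f₃ x + f₄ x - f₅ x + f₆ x) =
      (∫ x, f₁ x) + (∫ x, f₂ x) + (∫ x, f₃ x) + (∫ x, f₄ x) - (∫ x, f₅ x) + (∫ x, f₆ x) := by
  show ∫ x, (f₁ + f₂ + f₃ + f₄ - f₅ + f₆) x = _
  rw [integral_add' ((((h₁.add h₂).add h₃).add h₄).sub h₅) h₆,
    integral_sub' (((h₁.add h₂).add h₃).add h₄) h₅, integral_add' ((h₁.add h₂).add h₃) h₄,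
    integral_add' (h₁.add h₂) h₃, integral_add' h₁ h₂]

lemma integral_negLapPow_mul_profile {L : ℕ} (hL : 1 ≤ L) (m : ℕ) (A : ℝ) (i k : ℕ)
    (hk : 2 * m + 1 ≤ k) {κ : ℝ} (hκ : 0 < κ) {c : ℝ} (hc : 0 < c) {u : (𝔼 N) → ℝ}
    (hu : ContDiff ℝ (2 * m : ℕ) u) :
    ∫ x, negLapPow m u x * profile L A i k κ (c * ‖x‖ ^ 2) =
      c ^ m * ∫ x, u x * iterProfile N L m A i k κ (c * ‖x‖ ^ 2) := by
  induction m generalizing A i k with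
  | zero => simp [negLapPow, iterProfile]
  | succ m ih =>
    have hu' : ContDiff ℝ (2 * m : ℕ) u := hu.of_le (by norm_cast; omega)
    have hw : ContDiff ℝ 2 (negLapPow m u) :=
      contDiff_negLapPow m 2 (by convert hu using 2; ring)
    rw [negLapPow_succ, integral_neg_lap_mul_profile hL A i k (by omega) hκ hc hw]
    have hcu := hu.continuous
    have hcw := hw.continuous
    have e1 := ih (A + 1) i k (by omega) hu'
    have e2 := ih (A + 2) i k (by omega) hu'
    have e3 := ih (A + 1) (i + 1) (k - 1) (by omega) hu'
    have e4 := ih (A + 2) (i + 1) (k - 1) (by omega) hu'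
    have e5 := ih (A + 1) (i + 2) (k - 2) (by omega) hu'
    have e6 := ih (A + 2) (i + 2) (k - 2) (by omega) hu'
    have expand : ∀ (n : ℕ) (v : (𝔼 N) → ℝ), Continuous v → 2 * n + 3 ≤ k →
        ∫ x, v x * iterProfile N L (n + 1) A i k κ (c * ‖x‖ ^ 2) =
        (2 * N * (A - L * i) - 4 * ((A - L * i) * (A - L * i + 1))) *
          (∫ x, v x * iterProfile N L n (A + 1) i k κ (c * ‖x‖ ^ 2)) +
        4 * ((A - L * i) * (A - L * i + 1)) *
          (∫ x, v x * iterProfile N L n (A + 2) i k κ (c * ‖x‖ ^ 2)) +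
        (2 * N * (k * L) - 4 * (k * L * (2 * (A - L * i) + 1 - L))) *
          (∫ x, v x * iterProfile N L n (A + 1) (i + 1) (k - 1) κ (c * ‖x‖ ^ 2)) +
        4 * (k * L * (2 * (A - L * i) + 1 - L)) *
          (∫ x, v x * iterProfile N L n (A + 2) (i + 1) (k - 1) κ (c * ‖x‖ ^ 2)) -
        4 * (k * (k - 1) * L ^ 2) *
          (∫ x, v x * iterProfile N L n (A + 1) (i + 2) (k - 2) κ (c * ‖x‖ ^ 2)) +
        4 * (k * (k - 1) * L ^ 2) *
          (∫ x, v x * iterProfile N L n (A + 2) (i + 2) (k - 2) κ (c * ‖x‖ ^ 2)) := by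
      intro n v hv hn
      have I : ∀ (B : ℝ) (j l : ℕ), k - 2 ≤ l →
          Integrable fun x => v x * iterProfile N L n B j l κ (c * ‖x‖ ^ 2) :=
        fun B j l hl => integrable_mul_iterProfile L n B j l (by omega) hκ hc hv
      have i1 := (I (A + 1) i k (by omega)).const_mul
        (2 * N * (A - L * i) - 4 * ((A - L * i) * (A - L * i + 1)))
      have i2 := (I (A + 2) i k (by omega)).const_mul (4 * ((A - L * i) * (A - L * i + 1)))
      have i3 := (I (A + 1) (i + 1) (k - 1) (by omega)).const_mul
        (2 * N * (k * L) - 4 * (k * L * (2 * (A - L * i) + 1 - L)))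
      have i4 := (I (A + 2) (i + 1) (k - 1) (by omega)).const_mul
        (4 * (k * L * (2 * (A - L * i) + 1 - L)))
      have i5 := (I (A + 1) (i + 2) (k - 2) (by omega)).const_mul (4 * (k * (k - 1) * L ^ 2))
      have i6 := (I (A + 2) (i + 2) (k - 2) (by omega)).const_mul (4 * (k * (k - 1) * L ^ 2))
      simp only [← integral_const_mul]
      rw [← integral_six i1 i2 i3 i4 i5 i6]
      refine integral_congr_ae (Eventually.of_forall fun x => ?_)
      simp only [iterProfile]
      ring
    rw [expand 0 _ hcw (by omega), expand m _ hcu (by omega)]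
    simp only [iterProfile]
    rw [e1, e2, e3, e4, e5, e6]
    ring

end Profiles

section Bounds

lemma cutoff_nonneg (L : ℕ) (κ t : ℝ) : 0 ≤ cutoff L κ t := le_max_left _ _

lemma cutoff_le_one (L : ℕ) {κ t : ℝ} (hκ : 0 < κ) (ht : 0 ≤ t) : cutoff L κ t ≤ 1 :=
  max_le zero_le_one (by linarith [show 0 ≤ (κ * (1 + t)) ^ L by positivity])

lemma rpow_mul_cutoff_pow_mono (L : ℕ) {κ t : ℝ} (hκ : 0 < κ) (hκ' : κ ≤ 1) (ht : 0 ≤ t)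
    {A B : ℝ} (hAB : A ≤ B) {k l : ℕ} (hkl : k ≤ l) :
    κ ^ B * cutoff L κ t ^ l ≤ κ ^ A * cutoff L κ t ^ k :=
  mul_le_mul (Real.rpow_le_rpow_of_exponent_ge hκ hκ' hAB)
    (pow_le_pow_of_le_one (cutoff_nonneg L κ t) (cutoff_le_one L hκ ht) hkl)
    (pow_nonneg (cutoff_nonneg L κ t) _) (by positivity)

lemma abs_profile_le (L : ℕ) {A : ℝ} {i k : ℕ} (hi : 1 ≤ i) (hA : A ≤ L) (hk : 1 ≤ k) {κ t : ℝ}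
    (hκ : 0 < κ) (ht : 0 ≤ t) :
    |profile L A i k κ t| ≤ κ ^ A * cutoff L κ t ^ k := by
  have ht' : 0 < 1 + t := by linarith
  rcases le_or_gt 1 (κ * (1 + t)) with h | h
  · have h1 : 1 / κ - 1 ≤ t := by
      have : 1 / κ ≤ 1 + t := by rw [div_le_iff₀ hκ]; linarith
      linarith
    rw [profile_eq_zero L A i k hκ hk h1, abs_zero]
    exact mul_nonneg (by positivity) (pow_nonneg (cutoff_nonneg L κ t) _)
  · unfold profile
    have hc := pow_nonneg (cutoff_nonneg L κ t) k
    rw [abs_of_nonneg (mul_nonneg (by positivity) hc)]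
    refine mul_le_mul_of_nonneg_right ?_ hc
    have hLi : A ≤ (L : ℝ) * i := by
      have h2 : (1 : ℝ) ≤ i := by exact_mod_cast hi
      have : (L : ℝ) * 1 ≤ L * i := by gcongr
      linarith
    have e : κ ^ (L * i) * (1 + t) ^ (L * i - A : ℝ) =
        κ ^ A * (κ * (1 + t)) ^ (L * i - A : ℝ) := by
      rw [Real.mul_rpow hκ.le ht'.le, ← mul_assoc, ← Real.rpow_add hκ, ← Real.rpow_natCast]
      congr 2
      push_cast; ring
    rw [e]
    exact mul_le_of_le_one_right (by positivity)
      (Real.rpow_le_one (by positivity) h.le (by linarith))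

lemma abs_six_le {a₁ a₂ a₃ a₄ a₅ a₆ x₁ x₂ x₃ x₄ x₅ x₆ C₁ C₂ C₃ C₄ C₅ C₆ B : ℝ}
    (h₁ : |x₁| ≤ C₁ * B) (h₂ : |x₂| ≤ C₂ * B) (h₃ : |x₃| ≤ C₃ * B) (h₄ : |x₄| ≤ C₄ * B)
    (h₅ : |x₅| ≤ C₅ * B) (h₆ : |x₆| ≤ C₆ * B) :
    |a₁ * x₁ + a₂ * x₂ + a₃ * x₃ + a₄ * x₄ - a₅ * x₅ + a₆ * x₆| ≤
      (|a₁| * C₁ + |a₂| * C₂ + |a₃| * C₃ + |a₄| * C₄ + |a₅| * C₅ + |a₆| * C₆) * B := by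
  have key : ∀ {a x C : ℝ}, |x| ≤ C * B → |a * x| ≤ |a| * C * B := fun {a x C} h => by
    rw [abs_mul, mul_assoc]
    exact mul_le_mul_of_nonneg_left h (abs_nonneg a)
  have k₁ := abs_le.1 (key (a := a₁) h₁)
  have k₂ := abs_le.1 (key (a := a₂) h₂)
  have k₃ := abs_le.1 (key (a := a₃) h₃)
  have k₄ := abs_le.1 (key (a := a₄) h₄)
  have k₅ := abs_le.1 (key (a := a₅) h₅)
  have k₆ := abs_le.1 (key (a := a₆) h₆)
  rw [abs_le]
  constructor <;> linarith [k₁.1, k₁.2, k₂.1, k₂.2, k₃.1, k₃.2, k₄.1, k₄.2, k₅.1, k₅.2, k₆.1, k₆.2]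

/-- The correction terms, i.e. those with a positive power of `κ^L`, are of size `κ^{A+m}`. -/
lemma exists_abs_iterProfile_le (N L m : ℕ) (A : ℝ) (i k : ℕ) (hi : 1 ≤ i) (hA : A + 2 * m ≤ L)
    (hk : 2 * m + 1 ≤ k) :
    ∃ C, 0 ≤ C ∧ ∀ κ t : ℝ, 0 < κ → κ ≤ 1 → 0 ≤ t →
      |iterProfile N L m A i k κ t| ≤ C * (κ ^ (A + m) * cutoff L κ t ^ (k - 2 * m)) := by
  induction m generalizing A i k with
  | zero =>
    refine ⟨1, zero_le_one, fun κ t hκ hκ' ht => ?_⟩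
    simpa [iterProfile] using abs_profile_le L hi (by simpa using hA) (by omega) hκ ht
  | succ m ih =>
    push_cast at hA
    have ih' : ∀ (B : ℝ) (j l : ℕ), 1 ≤ j → A + 1 ≤ B → B ≤ A + 2 → k - 2 ≤ l →
        ∃ C, 0 ≤ C ∧ ∀ κ t : ℝ, 0 < κ → κ ≤ 1 → 0 ≤ t →
          |iterProfile N L m B j l κ t| ≤
            C * (κ ^ (A + (m + 1 : ℕ)) * cutoff L κ t ^ (k - 2 * (m + 1))) := by
      intro B j l hj h1 h2 hl
      obtain ⟨C, hC, h⟩ := ih B j l hj (by linarith) (by omega)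
      refine ⟨C, hC, fun κ t hκ hκ' ht => (h κ t hκ hκ' ht).trans ?_⟩
      exact mul_le_mul_of_nonneg_left (rpow_mul_cutoff_pow_mono L hκ hκ' ht
        (by push_cast; linarith) (by omega)) hC
    obtain ⟨C₁, p₁, h₁⟩ := ih' (A + 1) i k hi (by linarith) (by linarith) (by omega)
    obtain ⟨C₂, p₂, h₂⟩ := ih' (A + 2) i k hi (by linarith) (by linarith) (by omega)
    obtain ⟨C₃, p₃, h₃⟩ := ih' (A + 1) (i + 1) (k - 1) (by omega) (by linarith) (by linarith)
      (by omega)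
    obtain ⟨C₄, p₄, h₄⟩ := ih' (A + 2) (i + 1) (k - 1) (by omega) (by linarith) (by linarith)
      (by omega)
    obtain ⟨C₅, p₅, h₅⟩ := ih' (A + 1) (i + 2) (k - 2) (by omega) (by linarith) (by linarith)
      (by omega)
    obtain ⟨C₆, p₆, h₆⟩ := ih' (A + 2) (i + 2) (k - 2) (by omega) (by linarith) (by linarith)
      (by omega)
    refine ⟨_, ?_, fun κ t hκ hκ' ht => abs_six_le (h₁ κ t hκ hκ' ht) (h₂ κ t hκ hκ' ht)
      (h₃ κ t hκ hκ' ht) (h₄ κ t hκ hκ' ht) (h₅ κ t hκ hκ' ht) (h₆ κ t hκ hκ' ht)⟩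
    positivity

/-- For `i = 0` the main term is given by `mainCoeff`. -/
lemma exists_abs_iterProfile_sub_le (N L m : ℕ) (A : ℝ) (k : ℕ) (hA : A + 2 * m ≤ L)
    (hk : 2 * m + 1 ≤ k) :
    ∃ C, 0 ≤ C ∧ ∀ κ t : ℝ, 0 < κ → κ ≤ 1 → 0 ≤ t →
      |iterProfile N L m A 0 k κ t -
        (1 + t) ^ (-(A + m)) * mainCoeff N m A (1 + t)⁻¹ * cutoff L κ t ^ k| ≤
      C * (κ ^ (A + m) * cutoff L κ t ^ (k - 2 * m)) := by
  induction m generalizing A with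
  | zero =>
    refine ⟨0, le_rfl, fun κ t hκ hκ' ht => ?_⟩
    simp [iterProfile, profile, mainCoeff]
  | succ m ih =>
    push_cast at hA
    have ih' : ∀ (B : ℝ), A + 1 ≤ B → B ≤ A + 2 →
        ∃ C, 0 ≤ C ∧ ∀ κ t : ℝ, 0 < κ → κ ≤ 1 → 0 ≤ t →
          |iterProfile N L m B 0 k κ t -
            (1 + t) ^ (-(B + m)) * mainCoeff N m B (1 + t)⁻¹ * cutoff L κ t ^ k| ≤
            C * (κ ^ (A + (m + 1 : ℕ)) * cutoff L κ t ^ (k - 2 * (m + 1))) := by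
      intro B h1 h2
      obtain ⟨C, hC, h⟩ := ih B (by linarith) (by omega)
      refine ⟨C, hC, fun κ t hκ hκ' ht => (h κ t hκ hκ' ht).trans ?_⟩
      exact mul_le_mul_of_nonneg_left (rpow_mul_cutoff_pow_mono L hκ hκ' ht
        (by push_cast; linarith) (by omega)) hC
    have ih₂ : ∀ (B : ℝ) (j l : ℕ), 1 ≤ j → A + 1 ≤ B → B ≤ A + 2 → k - 2 ≤ l →
        ∃ C, 0 ≤ C ∧ ∀ κ t : ℝ, 0 < κ → κ ≤ 1 → 0 ≤ t →
          |iterProfile N L m B j l κ t| ≤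
            C * (κ ^ (A + (m + 1 : ℕ)) * cutoff L κ t ^ (k - 2 * (m + 1))) := by
      intro B j l hj h1 h2 hl
      obtain ⟨C, hC, h⟩ := exists_abs_iterProfile_le N L m B j l hj (by linarith) (by omega)
      refine ⟨C, hC, fun κ t hκ hκ' ht => (h κ t hκ hκ' ht).trans ?_⟩
      exact mul_le_mul_of_nonneg_left (rpow_mul_cutoff_pow_mono L hκ hκ' ht
        (by push_cast; linarith) (by omega)) hC
    obtain ⟨C₁, p₁, h₁⟩ := ih' (A + 1) (by linarith) (by linarith)
    obtain ⟨C₂, p₂, h₂⟩ := ih' (A + 2) (by linarith) (by linarith)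
    obtain ⟨C₃, p₃, h₃⟩ := ih₂ (A + 1) 1 (k - 1) (by omega) (by linarith) (by linarith) (by omega)
    obtain ⟨C₄, p₄, h₄⟩ := ih₂ (A + 2) 1 (k - 1) (by omega) (by linarith) (by linarith) (by omega)
    obtain ⟨C₅, p₅, h₅⟩ := ih₂ (A + 1) 2 (k - 2) (by omega) (by linarith) (by linarith) (by omega)
    obtain ⟨C₆, p₆, h₆⟩ := ih₂ (A + 2) 2 (k - 2) (by omega) (by linarith) (by linarith) (by omega)
    have key := fun κ t hκ hκ' ht =>
      abs_six_le (a₁ := 2 * N * A - 4 * (A * (A + 1))) (a₂ := 4 * (A * (A + 1)))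
        (a₃ := 2 * N * (k * L) - 4 * (k * L * (2 * A + 1 - L)))
        (a₄ := 4 * (k * L * (2 * A + 1 - L))) (a₅ := 4 * (k * (k - 1) * L ^ 2))
        (a₆ := 4 * (k * (k - 1) * L ^ 2)) (h₁ κ t hκ hκ' ht) (h₂ κ t hκ hκ' ht)
        (h₃ κ t hκ hκ' ht) (h₄ κ t hκ hκ' ht) (h₅ κ t hκ hκ' ht) (h₆ κ t hκ hκ' ht)
    refine ⟨_, ?_, fun κ t hκ hκ' ht =>
      le_trans (le_of_eq (congrArg _ ?_)) (key κ t hκ hκ' ht)⟩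
    · positivity
    · have e1 : (1 + t) ^ (-(A + 1 + m)) = (1 + t) ^ (-(A + (m + 1 : ℕ))) := by
        congr 1; push_cast; ring
      have e2 : (1 + t) ^ (-(A + 2 + m)) = (1 + t) ^ (-(A + (m + 1 : ℕ))) * (1 + t)⁻¹ := by
        rw [← Real.rpow_neg_one (1 + t), ← Real.rpow_add (by linarith)]
        congr 1; push_cast; ring
      rw [e1, e2]
      simp only [iterProfile, mainCoeff, Nat.cast_zero, mul_zero, sub_zero, zero_add]
      ring

lemma continuous_mainCoeff (N m : ℕ) (A : ℝ) : Continuous (mainCoeff N m A) := by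
  induction m generalizing A with
  | zero => exact continuous_const
  | succ m ih =>
    have h1 := ih (A + 1)
    have h2 := ih (A + 2)
    show Continuous fun v => mainCoeff N (m + 1) A v
    simp only [mainCoeff]
    fun_prop

lemma mainCoeff_succ_zero (N m : ℕ) (v : ℝ) : mainCoeff N (m + 1) 0 v = 0 := by
  simp [mainCoeff]

lemma mainCoeff_succ_neg (N m : ℕ) (A : ℝ) (hA : 0 < A) (h : 2 * A + 2 * (m + 1) = N + 1) :
    mainCoeff N (m + 1) A 0 < 0 := by
  induction m generalizing A with
  | zero =>
    simp only [mainCoeff, mul_one, mul_zero, add_zero]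
    push_cast at h
    nlinarith
  | succ m ih =>
    have := ih (A + 1) (by linarith) (by push_cast at h ⊢; linarith)
    rw [mainCoeff, zero_mul, mul_zero, add_zero]
    refine mul_neg_of_pos_of_neg ?_ this
    have hN : (N : ℝ) = 2 * A + 2 * (m + 2) - 1 := by push_cast at h; linarith
    rw [hN]
    have : (0 : ℝ) ≤ m := Nat.cast_nonneg m
    nlinarith [mul_nonneg hA.le this]

/-- The test function with `A = 0` satisfies `|(-Δ)^m φ| ≤ C κ^m w^{k-2m}`. -/
lemma exists_abs_iterProfile_zero_le (N L m k : ℕ) (hL : 2 * m ≤ L) (hm : 1 ≤ m)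
    (hk : 2 * m + 1 ≤ k) :
    ∃ C, 0 ≤ C ∧ ∀ κ t : ℝ, 0 < κ → κ ≤ 1 → 0 ≤ t →
      |iterProfile N L m 0 0 k κ t| ≤ C * cutoff L κ t ^ (k - 2 * m) := by
  obtain ⟨C, hC, h⟩ := exists_abs_iterProfile_sub_le N L m 0 k
    (by rw [zero_add]; exact_mod_cast hL) hk
  refine ⟨C, hC, fun κ t hκ hκ' ht => ?_⟩
  have h1 := h κ t hκ hκ' ht
  obtain ⟨n, rfl⟩ : ∃ n, m = n + 1 := ⟨m - 1, by omega⟩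
  rw [mainCoeff_succ_zero, mul_zero, zero_mul, sub_zero] at h1
  refine h1.trans (mul_le_mul_of_nonneg_left ?_ hC)
  exact mul_le_of_le_one_left (pow_nonneg (cutoff_nonneg _ _ _) _)
    (Real.rpow_le_one hκ.le hκ' (by positivity))

end Bounds

section TestInequality

variable {N : ℕ}

lemma exists_mainCoeff_neg (N m : ℕ) (hm : 1 ≤ m) {A : ℝ} (hA : 0 < A)
    (h : 2 * A + 2 * m = N + 1) :
    ∃ K : ℝ, 0 < K ∧ ∀ t, K ^ 2 ≤ t → mainCoeff N m A (1 + t)⁻¹ ≤ 0 := by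
  obtain ⟨n, rfl⟩ : ∃ n, m = n + 1 := ⟨m - 1, by omega⟩
  have h0 := mainCoeff_succ_neg N n A hA (by push_cast at h; linarith)
  have h1 := (continuous_mainCoeff N (n + 1) A).tendsto 0
  obtain ⟨ε, hε, hlt⟩ := Metric.eventually_nhds_iff.1 (h1.eventually (gt_mem_nhds h0))
  refine ⟨1 / ε + 1, by positivity, fun t ht => (hlt ?_).le⟩
  have hε' : 0 < 1 / ε := by positivity
  have ht' : 1 / ε < 1 + t := by nlinarith
  have ht0 : 0 < 1 + t := hε'.trans ht'
  rw [dist_zero_right, Real.norm_of_nonneg (by positivity)]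
  rw [inv_lt_comm₀ ht0 hε]
  simpa using ht'

lemma exists_abs_mainCoeff_le (N m : ℕ) (A : ℝ) :
    ∃ C, 0 ≤ C ∧ ∀ t, 0 ≤ t → |mainCoeff N m A (1 + t)⁻¹| ≤ C := by
  obtain ⟨C, hC⟩ := (isCompact_Icc (a := (0 : ℝ)) (b := 1)).exists_bound_of_continuousOn
    (continuous_mainCoeff N m A).continuousOn
  refine ⟨C, (norm_nonneg _).trans (hC 0 ⟨le_rfl, zero_le_one⟩), fun t ht => hC _ ⟨?_, ?_⟩⟩
  · positivity
  · exact inv_le_one_of_one_le₀ (by linarith)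

lemma cutoff_eq_zero (L : ℕ) {κ t : ℝ} (h : 1 ≤ κ * (1 + t)) : cutoff L κ t = 0 :=
  max_eq_left (by linarith [one_le_pow₀ (n := L) h])

/-- Upper bound for `(-Δ)^m` of the decaying test function: it is bounded near the origin,
non-positive up to a small error further away, and vanishes outside a large ball. -/
lemma exists_iterProfile_le (N m : ℕ) (hm : 1 ≤ m) (hN : 2 * m < N) {A : ℝ}
    (h : 2 * A + 2 * m = N + 1) {L : ℕ} (hL : A + 2 * m ≤ L) :
    ∃ K C : ℝ, 0 < K ∧ 0 ≤ C ∧ ∀ κ t : ℝ, 0 < κ → κ ≤ 1 → 0 ≤ t →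
      iterProfile N L m A 0 (2 * m + 1) κ t ≤
        (if t < K ^ 2 then C else 0) +
          (if κ * (1 + t) < 1 then C * κ ^ (((N + 1 : ℕ) : ℝ) / 2) else 0) := by
  have hA : 0 < A := by
    have : (2 * m : ℝ) < N := by exact_mod_cast hN
    linarith
  obtain ⟨K, hK, hneg⟩ := exists_mainCoeff_neg N m hm hA h
  obtain ⟨C₁, hC₁, hb⟩ := exists_abs_mainCoeff_le N m A
  obtain ⟨C₂, hC₂, hsub⟩ := exists_abs_iterProfile_sub_le N L m A (2 * m + 1) hL le_rfl
  refine ⟨K, C₁ + C₂, hK, by positivity, fun κ t hκ hκ' ht => ?_⟩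
  have h1 := (abs_le.1 (hsub κ t hκ hκ' ht)).2
  have e : A + m = ((N + 1 : ℕ) : ℝ) / 2 := by push_cast; linarith
  rw [e, show 2 * m + 1 - 2 * m = 1 by omega, pow_one] at h1
  have w0 := cutoff_nonneg L κ t
  have w1 := cutoff_le_one L hκ ht
  have p1 : 0 ≤ cutoff L κ t ^ (2 * m + 1) := by positivity
  have p2 : cutoff L κ t ^ (2 * m + 1) ≤ 1 := pow_le_one₀ w0 w1
  have r1 : (1 + t) ^ (-(((N + 1 : ℕ) : ℝ) / 2)) ≤ 1 :=
    Real.rpow_le_one_of_one_le_of_nonpos (by linarith) (by rw [neg_nonpos]; positivity)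
  have r0 : 0 ≤ (1 + t) ^ (-(((N + 1 : ℕ) : ℝ) / 2)) := by positivity
  have main : (1 + t) ^ (-(((N + 1 : ℕ) : ℝ) / 2)) * mainCoeff N m A (1 + t)⁻¹ *
      cutoff L κ t ^ (2 * m + 1) ≤ if t < K ^ 2 then C₁ + C₂ else 0 := by
    split_ifs with hlt
    · refine le_trans (le_abs_self _) ?_
      rw [abs_mul, abs_mul, abs_of_nonneg r0, abs_of_nonneg p1]
      have := mul_le_mul (mul_le_mul r1 (hb t ht) (abs_nonneg _) zero_le_one) p2 p1
        (by positivity)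
      linarith
    · exact mul_nonpos_of_nonpos_of_nonneg
        (mul_nonpos_of_nonneg_of_nonpos r0 (hneg t (not_lt.1 hlt))) p1
  have err : C₂ * (κ ^ (((N + 1 : ℕ) : ℝ) / 2) * cutoff L κ t) ≤
      if κ * (1 + t) < 1 then (C₁ + C₂) * κ ^ (((N + 1 : ℕ) : ℝ) / 2) else 0 := by
    have k0 : 0 ≤ κ ^ (((N + 1 : ℕ) : ℝ) / 2) := by positivity
    split_ifs with hlt
    · have : κ ^ (((N + 1 : ℕ) : ℝ) / 2) * cutoff L κ t ≤ κ ^ (((N + 1 : ℕ) : ℝ) / 2) :=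
        mul_le_of_le_one_right k0 w1
      nlinarith [mul_nonneg hC₁ k0]
    · rw [cutoff_eq_zero L (not_lt.1 hlt)]; simp
  linarith

lemma integrableOn_ball_of_continuous {w : (𝔼 N) → ℝ} (hw : Continuous w) (R : ℝ) :
    IntegrableOn w (ball 0 R) :=
  (hw.continuousOn.integrableOn_compact (isCompact_closedBall 0 R)).mono_set ball_subset_closedBall

/-- One-step estimate with a cutoff at radius `ρ`. -/
lemma exists_setIntegral_le_add (m : ℕ) (hm : 1 ≤ m) (hN : 2 * m < N) {u : (𝔼 N) → ℝ}
    (hu : ContDiff ℝ (2 * m : ℕ) u) (hpos : ∀ x, 0 ≤ u x) (hf : ∀ x, 0 ≤ negLapPow m u x) :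
    ∃ K C : ℝ, 0 < K ∧ 0 ≤ C ∧ ∀ R : ℝ, 0 < R → ∀ᶠ ρ in atTop,
      ∫ x in ball (0 : 𝔼 N) (K * R), negLapPow m u x ≤
        C * (R ^ (2 * m))⁻¹ * ((∫ x in ball (0 : 𝔼 N) (K * R), u x) +
          (R / ρ) ^ (N + 1) * ∫ x in ball (0 : 𝔼 N) ρ, u x) := by
  set A : ℝ := (N + 1) / 2 - m with hA
  have hNm : (2 * m : ℝ) < N := by exact_mod_cast hN
  have hm' : (1 : ℝ) ≤ m := by exact_mod_cast hm
  obtain ⟨K, C, hK, hC, hup⟩ := exists_iterProfile_le N m hm hN (A := A) (L := N + 2 * m)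
    (by rw [hA]; ring) (by rw [hA]; push_cast; linarith)
  have hcu := hu.continuous
  have hcf : Continuous (negLapPow m u) :=
    (contDiff_negLapPow m 0 (by simpa using hu)).continuous
  set τ : ℝ := (1 + K ^ 2) ^ (-A) * (1 / 2) ^ (2 * m + 1) with hτ
  have hτ0 : 0 < τ := by positivity
  refine ⟨K, C / τ, hK, by positivity, fun R hR => ?_⟩
  filter_upwards [eventually_ge_atTop (R * Real.sqrt (2 * (1 + K ^ 2))), eventually_gt_atTop 0]
    with ρ hρ hρ0
  set κ : ℝ := R ^ 2 / (R ^ 2 + ρ ^ 2) with hκ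
  have hκ0 : 0 < κ := by positivity
  have hκ1 : κ ≤ 1 := by rw [hκ, div_le_one (by positivity)]; nlinarith [sq_nonneg ρ]
  have hκK : κ * (1 + K ^ 2) ≤ 1 / 2 := by
    have h1 : (R * Real.sqrt (2 * (1 + K ^ 2))) ^ 2 ≤ ρ ^ 2 :=
      pow_le_pow_left₀ (by positivity) hρ 2
    rw [mul_pow, Real.sq_sqrt (by positivity)] at h1
    rw [hκ, div_mul_eq_mul_div, div_le_iff₀ (by positivity)]
    nlinarith [sq_nonneg R]
  have hκρ : κ ^ (((N + 1 : ℕ) : ℝ) / 2) ≤ (R / ρ) ^ (N + 1) := by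
    have h1 : κ ≤ (R / ρ) ^ 2 := by
      rw [hκ, div_pow]
      exact div_le_div_of_nonneg_left (by positivity) (by positivity) (by nlinarith [sq_nonneg R])
    calc κ ^ (((N + 1 : ℕ) : ℝ) / 2) ≤ ((R / ρ) ^ 2) ^ (((N + 1 : ℕ) : ℝ) / 2) :=
          Real.rpow_le_rpow hκ0.le h1 (by positivity)
      _ = (R / ρ) ^ (N + 1) := by
          rw [← Real.rpow_natCast (R / ρ) 2, ← Real.rpow_mul (by positivity), ← Real.rpow_natCast]
          congr 1; push_cast; ring
  have hc : 0 < (R ^ 2)⁻¹ := by positivity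
  have key := integral_negLapPow_mul_profile (L := N + 2 * m) (by omega) m A 0 (2 * m + 1) le_rfl
    hκ0 hc hu
  have hI := integrable_mul_iterProfile (N := N) (N + 2 * m) m A 0 (2 * m + 1) le_rfl hκ0 hc hcu
  have hJ := integrable_mul_iterProfile (N := N) (N + 2 * m) 0 A 0 (2 * m + 1) (by omega) hκ0 hc hcf
  simp only [iterProfile] at hJ
  -- membership in balls in terms of the rescaled variable
  have b1 : ∀ x : 𝔼 N, (R ^ 2)⁻¹ * ‖x‖ ^ 2 < K ^ 2 ↔ x ∈ ball (0 : 𝔼 N) (K * R) := fun x => by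
    rw [mem_ball_zero_iff, inv_mul_lt_iff₀ (by positivity), mul_comm K, ← mul_pow,
      pow_lt_pow_iff_left₀ (norm_nonneg _) (by positivity) two_ne_zero]
  have b2 : ∀ x : 𝔼 N, κ * (1 + (R ^ 2)⁻¹ * ‖x‖ ^ 2) < 1 ↔ x ∈ ball (0 : 𝔼 N) ρ := fun x => by
    rw [mem_ball_zero_iff, ← pow_lt_pow_iff_left₀ (norm_nonneg _) hρ0.le two_ne_zero]
    have e : κ * (1 + (R ^ 2)⁻¹ * ‖x‖ ^ 2) = (R ^ 2 + ‖x‖ ^ 2) / (R ^ 2 + ρ ^ 2) := by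
      rw [hκ]; field_simp
    rw [e, div_lt_one (by positivity), add_lt_add_iff_left]
  have upper : ∫ x, u x * iterProfile N (N + 2 * m) m A 0 (2 * m + 1) κ ((R ^ 2)⁻¹ * ‖x‖ ^ 2) ≤
      C * ((∫ x in ball (0 : 𝔼 N) (K * R), u x) +
          (R / ρ) ^ (N + 1) * ∫ x in ball (0 : 𝔼 N) ρ, u x) := by
    have i1 := (integrableOn_ball_of_continuous hcu (K * R)).integrable_indicator measurableSet_ball
    have i2 := (integrableOn_ball_of_continuous hcu ρ).integrable_indicator measurableSet_ball
    rw [← integral_indicator measurableSet_ball, ← integral_indicator measurableSet_ball,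
      ← integral_const_mul, ← integral_add i1 (i2.const_mul _), ← integral_const_mul]
    refine integral_mono hI ((i1.add (i2.const_mul _)).const_mul _) fun x => ?_
    beta_reduce
    have h1 := mul_le_mul_of_nonneg_left
      (hup κ ((R ^ 2)⁻¹ * ‖x‖ ^ 2) hκ0 hκ1 (by positivity)) (hpos x)
    refine h1.trans ?_
    have h2 := mul_le_mul_of_nonneg_left hκρ (mul_nonneg hC (hpos x))
    by_cases m1 : x ∈ ball (0 : 𝔼 N) (K * R) <;> by_cases m2 : x ∈ ball (0 : 𝔼 N) ρ <;>
      simp only [m1, m2, (b1 x).2, (b2 x).2, mt (b1 x).1, mt (b2 x).1, if_true, if_false,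
        not_false_eq_true, Set.indicator_of_mem, Set.indicator_of_notMem] <;>
      nlinarith
  have lower : τ * ∫ x in ball (0 : 𝔼 N) (K * R), negLapPow m u x ≤
      ∫ x, negLapPow m u x * profile (N + 2 * m) A 0 (2 * m + 1) κ ((R ^ 2)⁻¹ * ‖x‖ ^ 2) := by
    have i1 := (integrableOn_ball_of_continuous hcf (K * R)).integrable_indicator measurableSet_ball
    rw [← integral_indicator measurableSet_ball, ← integral_const_mul]
    refine integral_mono (i1.const_mul _) hJ fun x => ?_
    beta_reduce
    have ht : 0 ≤ (R ^ 2)⁻¹ * ‖x‖ ^ 2 := by positivity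
    have w0 := cutoff_nonneg (N + 2 * m) κ ((R ^ 2)⁻¹ * ‖x‖ ^ 2)
    simp only [profile, mul_zero, pow_zero, one_mul, Nat.cast_zero, zero_sub]
    by_cases hx : x ∈ ball (0 : 𝔼 N) (K * R)
    · rw [Set.indicator_of_mem hx]
      rw [mul_comm]
      refine mul_le_mul_of_nonneg_left ?_ (hf x)
      have hx' := (b1 x).2 hx
      refine mul_le_mul ?_ (pow_le_pow_left₀ (by norm_num) ?_ _) (by positivity) (by positivity)
      · exact Real.rpow_le_rpow_of_nonpos (by positivity) (by linarith)
          (by rw [hA]; linarith)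
      · refine le_trans ?_ (le_max_right _ _)
        have h1 : κ * (1 + (R ^ 2)⁻¹ * ‖x‖ ^ 2) ≤ 1 / 2 := by nlinarith
        have h2 : (κ * (1 + (R ^ 2)⁻¹ * ‖x‖ ^ 2)) ^ (N + 2 * m) ≤ 1 / 2 :=
          (pow_le_of_le_one (by positivity) (by linarith) (by omega)).trans h1
        linarith
    · rw [Set.indicator_of_notMem hx, mul_zero]
      have := hf x
      positivity
  rw [key, inv_pow, ← pow_mul] at lower
  rw [div_mul_eq_mul_div, div_mul_eq_mul_div, le_div_iff₀ hτ0]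
  have : 0 ≤ (R ^ (2 * m))⁻¹ := by positivity
  nlinarith [mul_le_mul_of_nonneg_left upper this]

lemma exists_setIntegral_negLapPow_le (m : ℕ) (hm : 1 ≤ m) (hN : 2 * m < N) {u : (𝔼 N) → ℝ}
    (hu : ContDiff ℝ (2 * m : ℕ) u) (hpos : ∀ x, 0 ≤ u x) (hf : ∀ x, 0 ≤ negLapPow m u x)
    (hgrowth : ∃ C, ∀ᶠ R : ℝ in atTop, ∫ x in ball (0 : 𝔼 N) R, u x ≤ C * R ^ N) :
    ∃ C : ℝ, 0 ≤ C ∧ ∀ R : ℝ, 0 < R → ∫ x in ball (0 : 𝔼 N) R, negLapPow m u x ≤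
      C * ((R ^ (2 * m))⁻¹ * ∫ x in ball (0 : 𝔼 N) R, u x) := by
  obtain ⟨K, C, hK, hC, h⟩ := exists_setIntegral_le_add m hm hN hu hpos hf
  obtain ⟨C₁, hC₁⟩ := hgrowth
  refine ⟨C * K ^ (2 * m), by positivity, fun R' hR' => ?_⟩
  obtain ⟨R, hR, rfl⟩ : ∃ R, 0 < R ∧ R' = K * R :=
    ⟨R' / K, by positivity, by field_simp⟩
  have lim : Tendsto (fun ρ : ℝ => C * (R ^ (2 * m))⁻¹ *
      ((∫ x in ball (0 : 𝔼 N) (K * R), u x) + C₁ * R ^ (N + 1) * ρ⁻¹)) atTop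
      (nhds (C * (R ^ (2 * m))⁻¹ *
        ((∫ x in ball (0 : 𝔼 N) (K * R), u x) + C₁ * R ^ (N + 1) * 0))) :=
    ((tendsto_inv_atTop_zero.const_mul _).const_add _).const_mul _
  have := ge_of_tendsto lim (b := ∫ x in ball (0 : 𝔼 N) (K * R), negLapPow m u x) (by
    filter_upwards [h R hR, hC₁, eventually_gt_atTop 0] with ρ h1 h2 h3
    refine h1.trans (mul_le_mul_of_nonneg_left (add_le_add le_rfl ?_) (by positivity))
    refine (mul_le_mul_of_nonneg_left h2 (by positivity)).trans (le_of_eq ?_)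
    rw [div_pow, pow_succ ρ]
    field_simp)
  refine this.trans (le_of_eq ?_)
  rw [mul_zero, add_zero, mul_pow]
  field_simp

end TestInequality

section Kernel

variable {N : ℕ}

lemma CondK.measurable {Ψ : ℝ → ℝ} (hK : CondK N Ψ) : Measurable fun x : 𝔼 N => Ψ ‖x‖ :=
  measurable_of_continuousOn_compl_singleton 0 hK.cont

lemma continuous_rpow_comp {u : (𝔼 N) → ℝ} (hu : Continuous u) {p : ℝ} (hp : 0 ≤ p) :
    Continuous fun x => u x ^ p :=
  hu.rpow_const fun _ => Or.inr hp

lemma integrable_rpow_mul_kernel {Ψ : ℝ → ℝ} (hK : CondK N Ψ) {p : ℝ} (hp : 0 < p)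
    {u : (𝔼 N) → ℝ} (hu : Continuous u) (hpos : ∀ x, 0 ≤ u x)
    (hint : IntegrableOn (fun y : 𝔼 N => u y ^ p * Ψ (‖y‖ / 2)) {y : 𝔼 N | 1 < ‖y‖}) (x : 𝔼 N) :
    Integrable fun y => u y ^ p * Ψ ‖y - x‖ := by
  have hcp := continuous_rpow_comp hu hp.le
  set ρ : ℝ := 2 * ‖x‖ + 1 with hρ
  have hmeas : Measurable fun y : 𝔼 N => Ψ ‖y - x‖ := hK.measurable.comp (by fun_prop)
  rw [← integrableOn_univ, ← Set.union_compl_self (closedBall (0 : 𝔼 N) ρ)]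
  refine IntegrableOn.union ?_ ?_
  · refine IntegrableOn.continuousOn_mul hcp.continuousOn ?_ (isCompact_closedBall 0 ρ)
    have h1 : IntegrableOn (fun y : 𝔼 N => Ψ ‖y‖) (closedBall 0 (ρ + ‖x‖)) :=
      hK.locInt.integrableOn_isCompact (isCompact_closedBall _ _)
    have h2 := ((measurePreserving_sub_right (volume : Measure (𝔼 N)) x).integrableOn_comp_preimage
      (measurableEmbedding_subRight x)).2 h1
    refine h2.mono_set fun y hy => ?_
    rw [mem_closedBall_zero_iff] at hy
    rw [Set.mem_preimage, mem_closedBall_zero_iff]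
    exact (norm_sub_le y x).trans (by linarith)
  · have hsub : (closedBall (0 : 𝔼 N) ρ)ᶜ ⊆ {y : 𝔼 N | 1 < ‖y‖} := fun y hy => by
      rw [Set.mem_compl_iff, mem_closedBall_zero_iff, not_le] at hy
      have := norm_nonneg x
      exact lt_of_le_of_lt (by linarith) hy
    refine (hint.mono_set hsub).mono' (hcp.measurable.mul hmeas).aestronglyMeasurable ?_
    filter_upwards [ae_restrict_mem measurableSet_closedBall.compl] with y hy
    rw [Set.mem_compl_iff, mem_closedBall_zero_iff, not_le] at hy
    have h0 := norm_nonneg x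
    have h1 := norm_sub_norm_le y x
    have h2 : ‖y‖ / 2 ≤ ‖y - x‖ := by linarith
    have h3 : 0 < ‖y‖ / 2 := by linarith
    have hu0 : 0 ≤ u y ^ p := Real.rpow_nonneg (hpos y) p
    rw [Real.norm_of_nonneg (mul_nonneg hu0 (hK.pos _ (h3.trans_le h2)).le)]
    exact mul_le_mul_of_nonneg_left (hK.anti h3 (h3.trans_le h2) h2) hu0

lemma ae_ne_of_pos (hN : 0 < N) (x : 𝔼 N) : ∀ᵐ y : 𝔼 N, y ≠ x := by
  have : Nonempty (Fin N) := ⟨⟨0, hN⟩⟩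
  have : Nontrivial (𝔼 N) := inferInstance
  exact compl_mem_ae_iff.2 (measure_singleton x)

lemma integral_kernel_ge (hN : 0 < N) {Ψ : ℝ → ℝ} (hK : CondK N Ψ) {p : ℝ} (hp : 0 < p)
    {u : (𝔼 N) → ℝ} (hu : Continuous u) (hpos : ∀ x, 0 ≤ u x)
    (hint : IntegrableOn (fun y : 𝔼 N => u y ^ p * Ψ (‖y‖ / 2)) {y : 𝔼 N | 1 < ‖y‖})
    {R : ℝ} {x : 𝔼 N} (hx : x ∈ ball (0 : 𝔼 N) R) {D : Set (𝔼 N)}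
    (hD : MeasurableSet D) (hDR : D ⊆ ball 0 R) :
    Ψ (2 * R) * ∫ y in D, u y ^ p ≤ ∫ y, u y ^ p * Ψ ‖y - x‖ := by
  have hI := integrable_rpow_mul_kernel hK hp hu hpos hint x
  have hne := ae_ne_of_pos hN x
  have hc := (integrableOn_ball_of_continuous (continuous_rpow_comp hu hp.le) R).mono_set hDR
  have hu0 : ∀ y, 0 ≤ u y ^ p := fun y => Real.rpow_nonneg (hpos y) p
  calc Ψ (2 * R) * ∫ y in D, u y ^ p = ∫ y in D, Ψ (2 * R) * u y ^ p :=
        (integral_const_mul _ _).symm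
    _ ≤ ∫ y in D, u y ^ p * Ψ ‖y - x‖ := by
        refine integral_mono_ae (hc.const_mul _) hI.integrableOn ?_
        filter_upwards [ae_restrict_mem hD, ae_restrict_of_ae hne] with y hy hyx
        rw [mul_comm]
        refine mul_le_mul_of_nonneg_left ?_ (hu0 y)
        have h1 : 0 < ‖y - x‖ := norm_pos_iff.2 (sub_ne_zero.2 hyx)
        have h2 : ‖y - x‖ ≤ 2 * R := by
          have e1 := mem_ball_zero_iff.1 (hDR hy)
          have e2 := mem_ball_zero_iff.1 hx
          linarith [norm_sub_le y x]
        exact hK.anti h1 (h1.trans_le h2) h2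
    _ ≤ ∫ y, u y ^ p * Ψ ‖y - x‖ := by
        refine setIntegral_le_integral hI ?_
        filter_upwards [hne] with y hyx
        exact mul_nonneg (hu0 y) (hK.pos _ (norm_pos_iff.2 (sub_ne_zero.2 hyx))).le

end Kernel

section Growth

variable {N : ℕ}

lemma volume_real_ball (R : ℝ) (hR : 0 < R) :
    volume.real (ball (0 : 𝔼 N) R) = volume.real (ball (0 : 𝔼 N) 1) * R ^ N := by
  rw [Measure.real, Measure.addHaar_ball_of_pos _ _ hR, ENNReal.toReal_mul,
    ENNReal.toReal_ofReal (by positivity), finrank_euclideanSpace_fin, mul_comm, Measure.real]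

lemma sq_integral_mul_le {α : Type*} [MeasurableSpace α] {μ : Measure α} {a b : α → ℝ}
    (ha : Integrable (fun x => a x ^ 2) μ) (hb : Integrable (fun x => b x ^ 2) μ)
    (hab : Integrable (fun x => a x * b x) μ) :
    (∫ x, a x * b x ∂μ) ^ 2 ≤ (∫ x, a x ^ 2 ∂μ) * ∫ x, b x ^ 2 ∂μ := by
  have h : ∀ s : ℝ, 0 ≤ (∫ x, a x ^ 2 ∂μ) * (s * s) + (2 * ∫ x, a x * b x ∂μ) * s +
      ∫ x, b x ^ 2 ∂μ := by
    intro s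
    have h0 : 0 ≤ ∫ x, (s * s * a x ^ 2 + 2 * s * (a x * b x)) + b x ^ 2 ∂μ :=
      integral_nonneg fun x => by
        change 0 ≤ (s * s * a x ^ 2 + 2 * s * (a x * b x)) + b x ^ 2
        nlinarith [sq_nonneg (s * a x + b x)]
    have i : Integrable (fun x => s * s * a x ^ 2 + 2 * s * (a x * b x)) μ :=
      (ha.const_mul _).add (hab.const_mul _)
    rw [integral_add i hb,
      integral_add (ha.const_mul _) (hab.const_mul _), integral_const_mul,
      integral_const_mul] at h0
    linarith
  have := discrim_le_zero h
  unfold discrim at this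
  linarith

lemma rpow_le_one_add_rpow {a s t : ℝ} (ha : 0 ≤ a) (hs : 0 ≤ s) (hst : s ≤ t) :
    a ^ s ≤ 1 + a ^ t := by
  rcases le_or_gt a 1 with h | h
  · linarith [Real.rpow_le_one ha h hs, Real.rpow_nonneg ha t]
  · linarith [Real.rpow_le_rpow_of_exponent_le h.le hst]

lemma exists_weight (N m : ℕ) (hm : 1 ≤ m) :
    ∃ C δ : ℝ, 0 ≤ C ∧ 0 < δ ∧ ∀ R : ℝ, 0 < R → ∃ W : (𝔼 N) → ℝ, Continuous W ∧ (∀ x, 0 ≤ W x) ∧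
      (∀ x, W x ≤ 1) ∧ (∀ x ∉ ball (0 : 𝔼 N) R, W x = 0) ∧
      (∀ x ∈ ball (0 : 𝔼 N) (R / 2), δ ≤ W x) ∧
      ∀ u : (𝔼 N) → ℝ, ContDiff ℝ (2 * m : ℕ) u → (∀ x, 0 ≤ u x) →
        ∫ x, negLapPow m u x * W x ^ 2 ≤ C * (R ^ (2 * m))⁻¹ * ∫ x, u x * W x := by
  obtain ⟨C, hC, h⟩ := exists_abs_iterProfile_zero_le N (2 * m) m (4 * m + 2) le_rfl hm (by omega)
  refine ⟨C, (3 / 8) ^ (2 * m + 1), hC, by positivity, fun R hR =>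
    ⟨fun x => cutoff (2 * m) (1 / 2) ((R ^ 2)⁻¹ * ‖x‖ ^ 2) ^ (2 * m + 1), ?_, fun x => ?_,
    fun x => ?_, fun x hx => ?_, fun x hx => ?_, fun u hu hpos => ?_⟩⟩
  · unfold cutoff; fun_prop
  · exact pow_nonneg (cutoff_nonneg _ _ _) _
  · exact pow_le_one₀ (cutoff_nonneg _ _ _) (cutoff_le_one _ (by norm_num) (by positivity))
  · beta_reduce
    rw [cutoff_eq_zero, zero_pow (by omega)]
    rw [mem_ball_zero_iff, not_lt] at hx
    have : 1 ≤ (R ^ 2)⁻¹ * ‖x‖ ^ 2 := by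
      rw [inv_mul_eq_div, one_le_div (by positivity)]
      exact pow_le_pow_left₀ hR.le hx 2
    linarith
  · refine pow_le_pow_left₀ (by norm_num) (le_trans ?_ (le_max_right _ _)) _
    rw [mem_ball_zero_iff] at hx
    have h1 : (R ^ 2)⁻¹ * ‖x‖ ^ 2 ≤ 1 / 4 := by
      rw [inv_mul_eq_div, div_le_iff₀ (by positivity)]
      nlinarith [norm_nonneg x]
    have h2 : (1 / 2 * (1 + (R ^ 2)⁻¹ * ‖x‖ ^ 2)) ^ (2 * m) ≤ 5 / 8 :=
      (pow_le_of_le_one (by positivity) (by linarith) (by omega)).trans (by linarith)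
    linarith
  · have hc : 0 < (R ^ 2)⁻¹ := by positivity
    have key := integral_negLapPow_mul_profile (L := 2 * m) (by omega) m 0 0 (4 * m + 2) (by omega)
      (κ := 1 / 2) (by norm_num) hc hu
    have e : ∀ x : 𝔼 N, negLapPow m u x * profile (2 * m) 0 0 (4 * m + 2) (1 / 2)
        ((R ^ 2)⁻¹ * ‖x‖ ^ 2) = negLapPow m u x *
          (cutoff (2 * m) (1 / 2) ((R ^ 2)⁻¹ * ‖x‖ ^ 2) ^ (2 * m + 1)) ^ 2 := fun x => by
      rw [← pow_mul, show (2 * m + 1) * 2 = 4 * m + 2 by ring]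
      simp [profile]
    simp only [e] at key
    rw [key, inv_pow, ← pow_mul, mul_assoc C, mul_left_comm C, ← integral_const_mul C]
    refine mul_le_mul_of_nonneg_left (integral_mono
      (integrable_mul_iterProfile (2 * m) m 0 0 (4 * m + 2) (by omega)
        (κ := 1 / 2) (by norm_num) hc hu.continuous) ?_ fun x => ?_) (by positivity)
    · refine (integrable_mul_radial (B := 1) hu.continuous (f := fun x : 𝔼 N =>
        cutoff (2 * m) (1 / 2) ((R ^ 2)⁻¹ * ‖x‖ ^ 2) ^ (2 * m + 1)) ?_ hc
        fun x hx => ?_).const_mul C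
      · unfold cutoff; fun_prop
      · rw [cutoff_eq_zero _ (by linarith), zero_pow (by omega)]
    · beta_reduce
      have w0 := cutoff_nonneg (2 * m) (1 / 2) ((R ^ 2)⁻¹ * ‖x‖ ^ 2)
      have w1 := cutoff_le_one (2 * m) (κ := 1 / 2) (t := (R ^ 2)⁻¹ * ‖x‖ ^ 2) (by norm_num)
        (by positivity)
      have h1 := (le_abs_self _).trans
        (h (1 / 2) ((R ^ 2)⁻¹ * ‖x‖ ^ 2) (by norm_num) (by norm_num) (by positivity))
      have h2 : cutoff (2 * m) (1 / 2) ((R ^ 2)⁻¹ * ‖x‖ ^ 2) ^ (4 * m + 2 - 2 * m) ≤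
          cutoff (2 * m) (1 / 2) ((R ^ 2)⁻¹ * ‖x‖ ^ 2) ^ (2 * m + 1) :=
        pow_le_pow_of_le_one w0 w1 (by omega)
      have h3 := mul_le_mul_of_nonneg_left (h1.trans (mul_le_mul_of_nonneg_left h2 hC)) (hpos x)
      linarith

lemma growth_of_one_le {Ψ : ℝ → ℝ} (hK : CondK N Ψ) {p : ℝ} (hp : 1 ≤ p) {u : (𝔼 N) → ℝ}
    (hu : Continuous u) (hpos : ∀ x, 0 ≤ u x)
    (hint : IntegrableOn (fun y : 𝔼 N => u y ^ p * Ψ (‖y‖ / 2)) {y : 𝔼 N | 1 < ‖y‖}) :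
    ∃ C, ∀ᶠ R : ℝ in atTop, ∫ x in ball (0 : 𝔼 N) R, u x ≤ C * R ^ N := by
  have hp0 : 0 < p := by linarith
  have hcp := continuous_rpow_comp hu hp0.le
  have hm1 : MeasurableSet {y : 𝔼 N | 1 < ‖y‖} :=
      (isOpen_lt continuous_const continuous_norm).measurableSet
  set g₁ := (closedBall (0 : 𝔼 N) 1).indicator fun y => u y ^ p with hg₁
  set g₂ := {y : 𝔼 N | 1 < ‖y‖}.indicator fun y => u y ^ p * Ψ (‖y‖ / 2) with hg₂
  have i₁ : Integrable g₁ := (hcp.continuousOn.integrableOn_compact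
    (isCompact_closedBall 0 1)).integrable_indicator measurableSet_closedBall
  have i₂ : Integrable g₂ := hint.integrable_indicator hm1
  have p₁ : ∀ y, 0 ≤ g₁ y := fun y =>
      Set.indicator_nonneg (fun z _ => Real.rpow_nonneg (hpos z) p) y
  have p₂ : ∀ y, 0 ≤ g₂ y := fun y => Set.indicator_nonneg (fun z hz =>
    mul_nonneg (Real.rpow_nonneg (hpos z) p)
      (hK.pos _ (by have : 1 < ‖z‖ := hz; linarith)).le) y
  refine ⟨volume.real (ball (0 : 𝔼 N) 1) + (∫ y, g₁ y) + ∫ y, g₂ y, ?_⟩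
  have hev : ∀ᶠ R : ℝ in atTop, 1 ≤ (R / 2) ^ N * Ψ (R / 2) :=
    (tendsto_id.atTop_div_const (by norm_num)).eventually (hK.tendsto.eventually_ge_atTop 1)
  filter_upwards [hev, eventually_ge_atTop 2] with R h1 h2
  have hR : 0 < R := by linarith
  have hΨ : 1 ≤ R ^ N * Ψ (R / 2) := h1.trans (mul_le_mul_of_nonneg_right
    (pow_le_pow_left₀ (by positivity) (by linarith) N) (hK.pos _ (by positivity)).le)
  have ic : IntegrableOn (fun _ : 𝔼 N => (1 : ℝ)) (ball 0 R) :=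
    integrableOn_ball_of_continuous continuous_const R
  have step : ∫ x in ball (0 : 𝔼 N) R, u x ≤
      ∫ x in ball (0 : 𝔼 N) R, (1 + g₁ x) + R ^ N * g₂ x := by
    refine setIntegral_mono_on (integrableOn_ball_of_continuous hu R)
      ((ic.add i₁.integrableOn).add (i₂.integrableOn.const_mul _)) measurableSet_ball fun x hx => ?_
    have hxR := mem_ball_zero_iff.1 hx
    have hup := rpow_le_one_add_rpow (hpos x) zero_le_one hp
    rw [Real.rpow_one] at hup
    rcases le_or_gt ‖x‖ 1 with h | h
    · have e1 : g₁ x = u x ^ p := Set.indicator_of_mem (mem_closedBall_zero_iff.2 h) _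
      have := mul_nonneg (pow_nonneg hR.le N) (p₂ x)
      linarith
    · have e1 : g₂ x = u x ^ p * Ψ (‖x‖ / 2) := Set.indicator_of_mem (s := {y : 𝔼 N | 1 < ‖y‖}) h _
      have h3 : 1 ≤ R ^ N * Ψ (‖x‖ / 2) := hΨ.trans (mul_le_mul_of_nonneg_left
        (hK.anti (Set.mem_Ioi.2 (by linarith)) (Set.mem_Ioi.2 (by linarith)) (by linarith))
        (by positivity))
      have := mul_le_mul_of_nonneg_left h3 (Real.rpow_nonneg (hpos x) p)
      have := p₁ x
      rw [e1]
      linarith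
  have e : ∫ x in ball (0 : 𝔼 N) R, (1 + g₁ x) + R ^ N * g₂ x =
      volume.real (ball (0 : 𝔼 N) 1) * R ^ N + (∫ x in ball (0 : 𝔼 N) R, g₁ x) +
        R ^ N * ∫ x in ball (0 : 𝔼 N) R, g₂ x := by
    have i : IntegrableOn (fun x => 1 + g₁ x) (ball (0 : 𝔼 N) R) := ic.add i₁.integrableOn
    rw [integral_add i (i₂.integrableOn.const_mul _),
      integral_add ic i₁.integrableOn, integral_const_mul, setIntegral_const, smul_eq_mul, mul_one,
      volume_real_ball R hR]
  have l₁ : ∫ x in ball (0 : 𝔼 N) R, g₁ x ≤ ∫ x, g₁ x :=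
    setIntegral_le_integral i₁ (Eventually.of_forall p₁)
  have l₂ : ∫ x in ball (0 : 𝔼 N) R, g₂ x ≤ ∫ x, g₂ x :=
    setIntegral_le_integral i₂ (Eventually.of_forall p₂)
  have hRN : 1 ≤ R ^ N := one_le_pow₀ (by linarith)
  have n₁ : 0 ≤ ∫ x, g₁ x := integral_nonneg p₁
  rw [e] at step
  nlinarith [mul_le_mul_of_nonneg_left l₂ (zero_le_one.trans hRN)]

end Growth

section GrowthSmall

variable {N : ℕ}

/-- Growth bound when `q ≥ 1`, from testing the inequality with a compactly supported weight. -/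
lemma growth_of_exponent_ge_one {m : ℕ} (hm : 1 ≤ m) {Ψ : ℝ → ℝ} (hK : CondK N Ψ) {p q : ℝ}
    (hp : 0 < p) (hp1 : p ≤ 1) (hpq : 2 ≤ p + q) {u : (𝔼 N) → ℝ}
    (hu : ContDiff ℝ (2 * m : ℕ) u) (hpos : ∀ x, 0 ≤ u x)
    (hf : ∀ R : ℝ, 0 < R → ∀ x ∈ ball (0 : 𝔼 N) R,
      (Ψ (2 * R) * ∫ y in ball (0 : 𝔼 N) R, u y ^ p) * u x ^ q ≤ negLapPow m u x) :
    ∃ C, ∀ᶠ R : ℝ in atTop, ∫ x in ball (0 : 𝔼 N) R, u x ≤ C * R ^ N := by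
  obtain ⟨C, δ, hC, hδ, hW⟩ := exists_weight N m hm
  have hq1 : 1 ≤ q := by linarith
  have hcu := hu.continuous
  have hcf : Continuous (negLapPow m u) :=
    (contDiff_negLapPow m 0 (by simpa using hu)).continuous
  set V₁ := volume.real (ball (0 : 𝔼 N) 1) with hV₁
  have hV₁0 : 0 ≤ V₁ := measureReal_nonneg
  suffices h : ∃ B, ∀ᶠ R : ℝ in atTop, ∫ x in ball (0 : 𝔼 N) (R / 2), u x ≤ B * R ^ N by
    obtain ⟨B, hB⟩ := h
    refine ⟨B * 2 ^ N, ?_⟩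
    filter_upwards [(tendsto_id.const_mul_atTop (two_pos (α := ℝ))).eventually hB] with R hR
    simp only [id, mul_div_cancel_left₀ R (two_ne_zero (α := ℝ)), mul_pow] at hR
    linarith
  refine ⟨2 * 2 ^ N * C / δ + V₁ * (1 + 1 / δ ^ 2), ?_⟩
  have hev : ∀ᶠ R : ℝ in atTop, 1 ≤ (2 * R) ^ N * Ψ (2 * R) :=
    (tendsto_id.const_mul_atTop two_pos).eventually (hK.tendsto.eventually_ge_atTop 1)
  filter_upwards [hev, eventually_ge_atTop 1] with R h1 h2
  have hR : 0 < R := by linarith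
  obtain ⟨W, Wc, W0, W1, Wout, Win, Wtest⟩ := hW R hR
  have hint : ∀ {w : (𝔼 N) → ℝ}, Continuous w → IntegrableOn w (ball 0 R) :=
    fun hw => integrableOn_ball_of_continuous hw R
  have hcp := continuous_rpow_comp hcu hp.le
  have hcq := continuous_rpow_comp hcu (zero_le_one.trans hq1)
  have hqW : Continuous fun x => u x ^ q * W x ^ 2 := hcq.mul (Wc.pow 2)
  have eq_ball : ∀ {w : (𝔼 N) → ℝ}, (∀ x ∉ ball (0 : 𝔼 N) R, w x = 0) →
      ∫ x, w x = ∫ x in ball (0 : 𝔼 N) R, w x :=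
    fun hw => (setIntegral_eq_integral_of_forall_compl_eq_zero hw).symm
  set S := ∫ x in ball (0 : 𝔼 N) R, u x * W x with hS
  set X := ∫ x in ball (0 : 𝔼 N) R, u x ^ p with hX
  set Y := ∫ x in ball (0 : 𝔼 N) R, u x ^ q * W x ^ 2 with hY
  set V := V₁ * R ^ N with hV
  have hX0 : 0 ≤ X := integral_nonneg fun x => Real.rpow_nonneg (hpos x) p
  have hY0 : 0 ≤ Y := integral_nonneg fun x =>
    mul_nonneg (Real.rpow_nonneg (hpos x) q) (sq_nonneg _)
  have hS0 : 0 ≤ S := integral_nonneg fun x => mul_nonneg (hpos x) (W0 x)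
  have test : ∫ x in ball (0 : 𝔼 N) R, negLapPow m u x * W x ^ 2 ≤ C * S := by
    have h3 := Wtest u hu hpos
    rw [eq_ball fun x hx => by rw [Wout x hx]; ring,
      eq_ball fun x hx => by rw [Wout x hx, mul_zero]] at h3
    refine h3.trans (mul_le_mul_of_nonneg_right (mul_le_of_le_one_right hC ?_) hS0)
    exact inv_le_one_of_one_le₀ (one_le_pow₀ h2)
  have hXY : Ψ (2 * R) * X * Y ≤ C * S := by
    refine le_trans ?_ test
    rw [hY, ← integral_const_mul]
    refine setIntegral_mono_on ((hint (hqW)).const_mul _)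
      (hint (hcf.mul (Wc.pow 2))) measurableSet_ball fun x hx => ?_
    have := mul_le_mul_of_nonneg_right (hf R hR x hx) (sq_nonneg (W x))
    linarith
  have hXY' : X * Y ≤ (2 * R) ^ N * (C * S) := by
    have h3 : 0 < (2 * R) ^ N := by positivity
    have h4 := mul_le_mul_of_nonneg_left hXY h3.le
    have h5 := mul_le_mul_of_nonneg_right h1 (mul_nonneg hX0 hY0)
    linarith
  have hvol : ∫ _ in ball (0 : 𝔼 N) R, (1 : ℝ) = V := by
    rw [setIntegral_const, smul_eq_mul, mul_one, volume_real_ball R hR]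
  have hc1 : Continuous fun _ : 𝔼 N => (1 : ℝ) := continuous_const
  have hZ : ∫ x in ball (0 : 𝔼 N) R, (u x ^ (1 - p / 2) * W x) ^ 2 ≤ V + Y := by
    rw [← hvol, hY, ← integral_add (hint hc1) (hint (hqW))]
    refine setIntegral_mono_on (hint (((continuous_rpow_comp hcu (by linarith)).mul Wc).pow 2))
      ((hint hc1).add (hint (hqW))) measurableSet_ball fun x hx => ?_
    have e : (u x ^ (1 - p / 2)) ^ 2 = u x ^ (2 - p) := by
      rw [← Real.rpow_natCast, ← Real.rpow_mul (hpos x)]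
      congr 1; push_cast; ring
    rw [mul_pow, e]
    have h3 := rpow_le_one_add_rpow (hpos x) (s := 2 - p) (t := q) (by linarith) (by linarith)
    have h4 := mul_le_mul_of_nonneg_right h3 (sq_nonneg (W x))
    have h5 : W x ^ 2 ≤ 1 := pow_le_one₀ (W0 x) (W1 x)
    linarith
  have hCS : S ^ 2 ≤ X * ∫ x in ball (0 : 𝔼 N) R, (u x ^ (1 - p / 2) * W x) ^ 2 := by
    have c1 : Continuous fun x => u x ^ (p / 2) := continuous_rpow_comp hcu (by linarith)
    have c2 : Continuous fun x => u x ^ (1 - p / 2) * W x :=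
      (continuous_rpow_comp hcu (by linarith)).mul Wc
    have h3 := sq_integral_mul_le (hint (c1.pow 2)) (hint (c2.pow 2)) (hint (c1.mul c2))
    have e1 : ∀ x, u x ^ (p / 2) * (u x ^ (1 - p / 2) * W x) = u x * W x := fun x => by
      rw [← mul_assoc, ← Real.rpow_add_of_nonneg (hpos x) (by linarith) (by linarith),
        add_sub_cancel, Real.rpow_one]
    have e2 : ∀ x, (u x ^ (p / 2)) ^ 2 = u x ^ p := fun x => by
      rw [← Real.rpow_natCast, ← Real.rpow_mul (hpos x)]
      congr 1; push_cast; ring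
    simp only [e1, e2] at h3
    exact h3
  have hsub : ball (0 : 𝔼 N) (R / 2) ⊆ ball 0 R := ball_subset_ball (by linarith)
  have hRN : 0 < R ^ N := by positivity
  have mono : ∀ {w : (𝔼 N) → ℝ}, Continuous w → (∀ x, 0 ≤ w x) →
      ∫ x in ball (0 : 𝔼 N) (R / 2), w x ≤ ∫ x in ball (0 : 𝔼 N) R, w x :=
    fun hw h0 => setIntegral_mono_set (hint hw) (Eventually.of_forall h0) hsub.eventuallyLE
  have ih : ∀ {w : (𝔼 N) → ℝ}, Continuous w → IntegrableOn w (ball 0 (R / 2)) :=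
    fun hw => integrableOn_ball_of_continuous hw _
  rcases le_or_gt V Y with hVY | hVY
  · have h3 : S ^ 2 ≤ 2 * ((2 * R) ^ N * (C * S)) := by
      have := mul_le_mul_of_nonneg_left (hZ.trans (by linarith : V + Y ≤ 2 * Y)) hX0
      linarith
    have h4 : S ≤ 2 * 2 ^ N * C * R ^ N := by
      rcases hS0.eq_or_lt with h0 | h0
      · rw [← h0]; positivity
      · rw [mul_pow] at h3
        by_contra! hlt
        nlinarith [mul_lt_mul_of_pos_right hlt h0]
    have h5 : δ * ∫ x in ball (0 : 𝔼 N) (R / 2), u x ≤ S := by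
      refine le_trans ?_ (mono (hcu.mul Wc) fun x => mul_nonneg (hpos x) (W0 x))
      rw [← integral_const_mul]
      refine setIntegral_mono_on ((ih hcu).const_mul _) (ih (hcu.mul Wc)) measurableSet_ball
        fun x hx => ?_
      have := mul_le_mul_of_nonneg_right (Win x hx) (hpos x)
      linarith
    have h6 : ∫ x in ball (0 : 𝔼 N) (R / 2), u x ≤ 2 * 2 ^ N * C / δ * R ^ N := by
      rw [div_mul_eq_mul_div, le_div_iff₀ hδ]
      linarith
    have h7 : 0 ≤ V₁ * (1 + 1 / δ ^ 2) * R ^ N := by positivity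
    linarith
  · have h3 : ∫ x in ball (0 : 𝔼 N) (R / 2), u x ≤
        ∫ x in ball (0 : 𝔼 N) (R / 2), (1 + 1 / δ ^ 2 * (u x ^ q * W x ^ 2)) := by
      refine setIntegral_mono_on (ih hcu) ((ih hc1).add ((ih (hqW)).const_mul _))
        measurableSet_ball fun x hx => ?_
      have h4 := rpow_le_one_add_rpow (hpos x) zero_le_one hq1
      rw [Real.rpow_one] at h4
      have h5 : 1 ≤ 1 / δ ^ 2 * W x ^ 2 := by
        rw [one_div, inv_mul_eq_div, one_le_div (by positivity)]
        exact pow_le_pow_left₀ hδ.le (Win x hx) 2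
      have h6 := mul_le_mul_of_nonneg_left h5 (Real.rpow_nonneg (hpos x) q)
      linarith
    have h4 := mono (w := fun x => 1 + 1 / δ ^ 2 * (u x ^ q * W x ^ 2)) (by fun_prop)
      fun x => by have := Real.rpow_nonneg (hpos x) q; positivity
    rw [integral_add (hint hc1) ((hint (hqW)).const_mul _), hvol,
      integral_const_mul] at h4
    have h5 : 1 / δ ^ 2 * Y ≤ 1 / δ ^ 2 * V :=
      mul_le_mul_of_nonneg_left hVY.le (by positivity)
    have h6 : 0 ≤ 2 * 2 ^ N * C / δ * R ^ N := by positivity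
    have h7 : V + 1 / δ ^ 2 * V = V₁ * (1 + 1 / δ ^ 2) * R ^ N := by rw [hV]; ring
    linarith

end GrowthSmall

section Conclusion

variable {N : ℕ}

lemma mul_rpow_div_le_integral_rpow {u : (𝔼 N) → ℝ} (hu : Continuous u) (hpos : ∀ x, 0 ≤ u x)
    {s : ℝ} (hs : 1 ≤ s) {R V : ℝ} {D : Set (𝔼 N)} (hDR : D ⊆ ball 0 R)
    (hV : 0 < V) (hDV : volume.real D ≤ V) :
    V * ((∫ x in D, u x) / V) ^ s ≤ ∫ x in D, u x ^ s := by
  have hint : ∀ {w : (𝔼 N) → ℝ}, Continuous w → IntegrableOn w D :=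
    fun hw => (integrableOn_ball_of_continuous hw R).mono_set hDR
  have h0 : 0 ≤ ∫ x in D, u x := integral_nonneg hpos
  rcases h0.eq_or_lt with h | h
  · rw [← h, zero_div, Real.zero_rpow (by linarith), mul_zero]
    exact integral_nonneg fun x => Real.rpow_nonneg (hpos x) s
  · set I := ∫ x in D, u x with hI
    have hl : 0 < I / V := by positivity
    have hls : 0 < (I / V) ^ s := by positivity
    have hcs := continuous_rpow_comp hu (zero_le_one.trans hs)
    have hc1 : Continuous fun _ : 𝔼 N => 1 - s := continuous_const
    have key : ∫ x in D, ((1 - s) + s / (I / V) * u x) ≤ ∫ x in D, ((I / V) ^ s)⁻¹ * u x ^ s := by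
      refine integral_mono ((hint hc1).add ((hint hu).const_mul _)) ((hint hcs).const_mul _)
        fun x => ?_
      have h1 := one_add_mul_self_le_rpow_one_add (s := u x / (I / V) - 1) (p := s)
        (by linarith [div_nonneg (hpos x) hl.le]) hs
      rw [add_sub_cancel, Real.div_rpow (hpos x) hl.le] at h1
      beta_reduce
      rw [inv_mul_eq_div]
      refine le_trans (le_of_eq ?_) h1
      ring
    rw [integral_add (hint hc1) ((hint hu).const_mul _), integral_const_mul, integral_const_mul,
      setIntegral_const, smul_eq_mul, ← hI, inv_mul_eq_div, le_div_iff₀ hls] at key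
    have e : s / (I / V) * I = s * V := by field_simp
    rw [e] at key
    refine le_trans (mul_le_mul_of_nonneg_right ?_ hls.le) key
    nlinarith

/-- Reverse form of Hölder's inequality for two powers of a single function. -/
lemma sq_mul_rpow_div_le {u : (𝔼 N) → ℝ} (hu : Continuous u) (hpos : ∀ x, 0 ≤ u x)
    {p q : ℝ} (hp : 0 < p) (hq : 0 < q) (hpq : 2 ≤ p + q) {R V : ℝ} {D : Set (𝔼 N)}
    (hDR : D ⊆ ball 0 R) (hV : 0 < V) (hDV : volume.real D ≤ V) :
    V ^ 2 * ((∫ x in D, u x) / V) ^ (p + q) ≤ (∫ x in D, u x ^ p) * ∫ x in D, u x ^ q := by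
  have hint : ∀ {w : (𝔼 N) → ℝ}, Continuous w → IntegrableOn w D :=
    fun hw => (integrableOn_ball_of_continuous hw R).mono_set hDR
  have h1 := mul_rpow_div_le_integral_rpow hu hpos (s := (p + q) / 2) (by linarith) hDR hV hDV
  have h0 : 0 ≤ (∫ x in D, u x) / V := div_nonneg (integral_nonneg hpos) hV.le
  have c1 : Continuous fun x => u x ^ (p / 2) := continuous_rpow_comp hu (by linarith)
  have c2 : Continuous fun x => u x ^ (q / 2) := continuous_rpow_comp hu (by linarith)
  have h2 := sq_integral_mul_le (hint (c1.pow 2)) (hint (c2.pow 2)) (hint (c1.mul c2))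
  have half : ∀ {a : ℝ} (s : ℝ), 0 ≤ a → (a ^ (s / 2)) ^ 2 = a ^ s := fun s ha => by
    rw [← Real.rpow_natCast, ← Real.rpow_mul ha]
    congr 1; push_cast; ring
  have e1 : ∀ x, u x ^ (p / 2) * u x ^ (q / 2) = u x ^ ((p + q) / 2) := fun x => by
    rw [← Real.rpow_add_of_nonneg (hpos x) (by linarith) (by linarith), add_div]
  simp only [e1, half _ (hpos _)] at h2
  refine le_trans ?_ h2
  rw [← half (p + q) h0, ← mul_pow]
  exact pow_le_pow_left₀ (by positivity) h1 2

lemma frequently_increment_le {m : ℕ} {Ψ : ℝ → ℝ} (hK : CondK N Ψ) {p q : ℝ} (hp : 0 < p)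
    (hq : 0 < q) (hpq : 2 ≤ p + q)
    (hlimsup : ∃ c : ℝ, 0 < c ∧
      ∃ᶠ r : ℝ in atTop, c ≤ r ^ (2 * (N : ℝ) - ((N : ℝ) - 2 * m) * (p + q)) * Ψ r)
    {u f : (𝔼 N) → ℝ} (hu : Continuous u) (hcf : Continuous f) (hpos : ∀ x, 0 ≤ u x)
    (hf : ∀ R : ℝ, ∀ D ⊆ ball (0 : 𝔼 N) R, MeasurableSet D → ∀ x ∈ ball (0 : 𝔼 N) R,
      (Ψ (2 * R) * ∫ y in D, u y ^ p) * u x ^ q ≤ f x) :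
    ∃ c : ℝ, 0 < c ∧ ∃ᶠ R : ℝ in atTop, ∀ r, r ≤ R →
      c * ((R ^ (2 * m))⁻¹ * ((∫ x in ball (0 : 𝔼 N) R, u x) -
        ∫ x in ball (0 : 𝔼 N) r, u x)) ^ (p + q) ≤
      (∫ x in ball (0 : 𝔼 N) R, f x) - ∫ x in ball (0 : 𝔼 N) r, f x := by
  obtain ⟨c, hc, hfreq⟩ := hlimsup
  set β : ℝ := 2 * (N : ℝ) - ((N : ℝ) - 2 * m) * (p + q) with hβ
  set V₁ := volume.real (ball (0 : 𝔼 N) 1) with hV₁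
  have hV₁0 : 0 < V₁ :=
    ENNReal.toReal_pos (measure_ball_pos volume 0 one_pos).ne' measure_ball_lt_top.ne
  refine ⟨c * 2 ^ (-β) * (V₁ ^ 2 * (V₁ ^ (p + q))⁻¹), by positivity, ?_⟩
  have hfreq' : ∃ᶠ R : ℝ in atTop, c ≤ (2 * R) ^ β * Ψ (2 * R) := by
    rw [frequently_atTop] at hfreq ⊢
    intro a
    obtain ⟨b, hb, h⟩ := hfreq (2 * a)
    exact ⟨b / 2, by linarith, by rwa [mul_div_cancel₀ b two_ne_zero]⟩
  refine (hfreq'.and_eventually (eventually_gt_atTop 0)).mono fun R ⟨h1, hR⟩ r hr => ?_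
  set D := ball (0 : 𝔼 N) R \ ball 0 r with hD
  have hDm : MeasurableSet D := measurableSet_ball.diff measurableSet_ball
  have hDR : D ⊆ ball 0 R := Set.sdiff_subset
  have hint : ∀ {w : (𝔼 N) → ℝ}, Continuous w → IntegrableOn w (ball 0 R) :=
    fun hw => integrableOn_ball_of_continuous hw R
  have hdiff : ∀ {w : (𝔼 N) → ℝ}, Continuous w → ∫ x in D, w x =
      (∫ x in ball (0 : 𝔼 N) R, w x) - ∫ x in ball (0 : 𝔼 N) r, w x :=
    fun hw => setIntegral_sdiff measurableSet_ball (hint hw) (ball_subset_ball hr)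
  have hcq := continuous_rpow_comp hu hq.le
  have hΨ : 0 < Ψ (2 * R) := hK.pos _ (by linarith)
  have hDV : volume.real D ≤ V₁ * R ^ N := by
    rw [← volume_real_ball R hR]
    exact measureReal_mono hDR measure_ball_lt_top.ne
  have hI0 : 0 ≤ ∫ x in D, u x := integral_nonneg hpos
  have hH := sq_mul_rpow_div_le hu hpos hp hq hpq hDR (V := V₁ * R ^ N) (by positivity) hDV
  have hlow : (Ψ (2 * R) * ∫ y in D, u y ^ p) * ∫ x in D, u x ^ q ≤ ∫ x in D, f x := by
    rw [← integral_const_mul]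
    exact setIntegral_mono_on (((hint hcq).mono_set hDR).const_mul _) ((hint hcf).mono_set hDR) hDm
      fun x hx => hf R D hDR hDm x (hDR hx)
  rw [← hdiff hu, ← hdiff hcf]
  refine le_trans ?_ hlow
  rw [mul_assoc (Ψ (2 * R))]
  refine le_trans ?_ (mul_le_mul_of_nonneg_left hH hΨ.le)
  set I := ∫ x in D, u x with hI
  have h2 : c * 2 ^ (-β) ≤ R ^ β * Ψ (2 * R) := by
    rw [Real.mul_rpow two_pos.le hR.le] at h1
    rw [Real.rpow_neg two_pos.le, ← div_eq_mul_inv, div_le_iff₀ (by positivity)]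
    linarith
  have e : Ψ (2 * R) * ((V₁ * R ^ N) ^ 2 * (I / (V₁ * R ^ N)) ^ (p + q)) =
      R ^ β * Ψ (2 * R) * (V₁ ^ 2 * (V₁ ^ (p + q))⁻¹) * ((R ^ (2 * m))⁻¹ * I) ^ (p + q) := by
    rw [Real.div_rpow hI0 (by positivity), Real.mul_rpow hV₁0.le (by positivity),
      Real.mul_rpow (by positivity) hI0, Real.inv_rpow (by positivity)]
    have e1 : R ^ β = (R ^ N) ^ 2 * ((R ^ N) ^ (p + q))⁻¹ * (R ^ (2 * m)) ^ (p + q) := by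
      rw [← Real.rpow_natCast R N, ← Real.rpow_natCast R (2 * m), ← Real.rpow_natCast _ 2,
        ← Real.rpow_mul hR.le, ← Real.rpow_mul hR.le, ← Real.rpow_mul hR.le,
        ← Real.rpow_neg hR.le, ← Real.rpow_add hR, ← Real.rpow_add hR, hβ]
      congr 1; push_cast; ring
    rw [e1]
    have : (R ^ (2 * m)) ^ (p + q) ≠ 0 := by positivity
    field_simp
  rw [e]
  gcongr

/-- A monotone function that is controlled by a rescaled density, whose increments in turn control
a superlinear power of the density, cannot be positive. -/
lemma nonpos_of_increment_le {F U : ℝ → ℝ} {C c s : ℝ} {n : ℕ} (hn : 1 ≤ n) (hs : 2 ≤ s)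
    (hc : 0 < c) (hC : 0 ≤ C) (hF : Monotone F) (hF0 : F 0 = 0) (hU0 : U 0 = 0)
    (hFU : ∀ R, 0 < R → F R ≤ C * ((R ^ n)⁻¹ * U R))
    (hinc : ∃ᶠ R : ℝ in atTop, ∀ r, r ≤ R → c * ((R ^ n)⁻¹ * (U R - U r)) ^ s ≤ F R - F r)
    {R₁ : ℝ} (hR₁ : 0 < R₁) : F R₁ ≤ 0 := by
  by_contra! hpos
  have hC' : 0 < C := by
    refine hC.lt_of_ne fun h => ?_
    have := hFU R₁ hR₁
    rw [← h, zero_mul] at this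
    linarith
  have hJ : ∀ R, R₁ ≤ R → F R₁ / C ≤ (R ^ n)⁻¹ * U R := fun R hR => by
    rw [div_le_iff₀ hC']
    linarith [hFU R (hR₁.trans_le hR), hF hR]
  have hbdd : ∀ R, F R ≤ C * (1 + C / c) := by
    intro R
    obtain ⟨R', h, h1⟩ := (hinc.and_eventually (eventually_ge_atTop (max R R₁))).exists
    have h2 := h 0 (hR₁.le.trans ((le_max_right _ _).trans h1))
    rw [hU0, hF0, sub_zero, sub_zero] at h2
    have h3 := hFU R' (hR₁.trans_le ((le_max_right _ _).trans h1))
    have h4 := hJ R' ((le_max_right _ _).trans h1)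
    set J := (R' ^ n)⁻¹ * U R' with hJdef
    have h5 : J ≤ 1 + C / c := by
      rcases le_or_gt J 1 with h6 | h6
      · linarith [div_pos hC' hc]
      · have h7 : J ^ (2 : ℝ) ≤ J ^ s := Real.rpow_le_rpow_of_exponent_le h6.le hs
        rw [Real.rpow_two] at h7
        have h8 : c * J ^ 2 ≤ C * J := (mul_le_mul_of_nonneg_left h7 hc.le).trans (h2.trans h3)
        have h9 : J ≤ C / c := by
          rw [le_div_iff₀ hc]
          nlinarith
        linarith
    exact (hF ((le_max_left _ _).trans h1)).trans (h3.trans (mul_le_mul_of_nonneg_left h5 hC))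
  have hB : BddAbove (Set.range F) := ⟨_, by rintro _ ⟨R, rfl⟩; exact hbdd R⟩
  set j := F R₁ / C / 2 with hj
  have hj0 : 0 < j := by positivity
  have hη : 0 < c * j ^ s := by positivity
  obtain ⟨r, hr⟩ := exists_lt_of_lt_ciSup (show (⨆ R, F R) - c * j ^ s < ⨆ R, F R by linarith)
  have hlim : Tendsto (fun R : ℝ => (R ^ n)⁻¹ * U r) atTop (nhds (0 * U r)) :=
    ((tendsto_pow_atTop (by omega)).inv_tendsto_atTop).mul_const _
  rw [zero_mul] at hlim
  obtain ⟨R, h, h1, h2, h3⟩ := (hinc.and_eventually ((hlim.eventually (gt_mem_nhds hj0)).and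
    ((eventually_ge_atTop R₁).and (eventually_ge_atTop r)))).exists
  have h4 := h r h3
  have h5 := hJ R h2
  have h6 : j ≤ (R ^ n)⁻¹ * (U R - U r) := by
    rw [mul_sub]
    linarith
  have h7 : j ^ s ≤ ((R ^ n)⁻¹ * (U R - U r)) ^ s := Real.rpow_le_rpow hj0.le h6 (by linarith)
  have h8 := mul_le_mul_of_nonneg_left h7 hc.le
  linarith [le_ciSup hB R]

lemma setIntegral_ball_pos {w : (𝔼 N) → ℝ} (hw : Continuous w) (hpos : ∀ x, 0 ≤ w x) {R : ℝ}
    {x : 𝔼 N} (hx : x ∈ ball (0 : 𝔼 N) R) (hwx : 0 < w x) : 0 < ∫ y in ball (0 : 𝔼 N) R, w y := by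
  rw [setIntegral_pos_iff_support_of_nonneg_ae (Eventually.of_forall hpos)
    (integrableOn_ball_of_continuous hw R)]
  exact (hw.isOpen_support.inter isOpen_ball).measure_pos volume ⟨x, hwx.ne', hx⟩

end Conclusion

theorem stmt_5 (N m : ℕ) (hm : 1 ≤ m) (hN : 2 * m < N)
    (Ψ : ℝ → ℝ) (hK : CondK N Ψ)
    (p q : ℝ) (hp : 0 < p) (hq : 0 < q) (hpq : 2 ≤ p + q)
    (hlimsup : ∃ c : ℝ, 0 < c ∧
      ∃ᶠ r : ℝ in atTop, c ≤ r ^ (2 * (N : ℝ) - ((N : ℝ) - 2 * m) * (p + q)) * Ψ r)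
    (u : EuclideanSpace ℝ (Fin N) → ℝ)
    (hreg : ContDiff ℝ (2 * m) u)
    (hpos : ∀ x, 0 ≤ u x)
    (hint : IntegrableOn (fun y : EuclideanSpace ℝ (Fin N) => u y ^ p * Ψ (‖y‖ / 2))
      {y : EuclideanSpace ℝ (Fin N) | 1 < ‖y‖})
    (hineq : ∀ x : EuclideanSpace ℝ (Fin N),
      (∫ y : EuclideanSpace ℝ (Fin N), u y ^ p * Ψ ‖y - x‖) * u x ^ q ≤ negLapPow m u x) :
    ∀ x, u x = 0 := by
  have hN0 : 0 < N := by omega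
  have hu : ContDiff ℝ (2 * m : ℕ) u := by exact_mod_cast hreg
  have hcu := hu.continuous
  have hcf : Continuous (negLapPow m u) :=
    (contDiff_negLapPow m 0 (by simpa using hu)).continuous
  have hlow : ∀ R : ℝ, ∀ D ⊆ ball (0 : 𝔼 N) R, MeasurableSet D → ∀ x ∈ ball (0 : 𝔼 N) R,
      (Ψ (2 * R) * ∫ y in D, u y ^ p) * u x ^ q ≤ negLapPow m u x := fun R D hDR hD x hx =>
    (mul_le_mul_of_nonneg_right (integral_kernel_ge hN0 hK hp hcu hpos hint hx hD hDR)
      (Real.rpow_nonneg (hpos x) q)).trans (hineq x)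
  have hlow' : ∀ R : ℝ, 0 < R → ∀ x ∈ ball (0 : 𝔼 N) R,
      (Ψ (2 * R) * ∫ y in ball (0 : 𝔼 N) R, u y ^ p) * u x ^ q ≤ negLapPow m u x :=
    fun R _ x hx => hlow R _ subset_rfl measurableSet_ball x hx
  have hf : ∀ x, 0 ≤ negLapPow m u x := fun x => by
    have hx : x ∈ ball (0 : 𝔼 N) (‖x‖ + 1) := mem_ball_zero_iff.2 (lt_add_one _)
    refine le_trans ?_ (hlow' (‖x‖ + 1) (by positivity) x hx)
    have h1 : 0 < Ψ (2 * (‖x‖ + 1)) := hK.pos _ (by positivity)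
    have h2 : 0 ≤ ∫ y in ball (0 : 𝔼 N) (‖x‖ + 1), u y ^ p :=
      integral_nonneg fun y => Real.rpow_nonneg (hpos y) p
    have h3 := Real.rpow_nonneg (hpos x) q
    positivity
  have hgrowth : ∃ C, ∀ᶠ R : ℝ in atTop, ∫ x in ball (0 : 𝔼 N) R, u x ≤ C * R ^ N := by
    rcases le_total 1 p with h | h
    · exact growth_of_one_le hK h hcu hpos hint
    · exact growth_of_exponent_ge_one hm hK hp h hpq hu hpos hlow'
  obtain ⟨C, hC, hFU⟩ := exists_setIntegral_negLapPow_le m hm hN hu hpos hf hgrowth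
  obtain ⟨c, hc, hinc⟩ := frequently_increment_le hK hp hq hpq hlimsup hcu hcf hpos hlow
  have hmono : Monotone fun R : ℝ => ∫ x in ball (0 : 𝔼 N) R, negLapPow m u x := fun r R hrR =>
    setIntegral_mono_set (integrableOn_ball_of_continuous hcf R) (Eventually.of_forall hf)
      (ball_subset_ball hrR).eventuallyLE
  intro x
  by_contra hx
  have hux : 0 < u x := (hpos x).lt_of_ne (Ne.symm hx)
  have hxR : x ∈ ball (0 : 𝔼 N) (‖x‖ + 1) := mem_ball_zero_iff.2 (lt_add_one _)
  have hfx : 0 < negLapPow m u x := by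
    refine lt_of_lt_of_le ?_ (hlow' (‖x‖ + 1) (by positivity) x hxR)
    have h1 : 0 < Ψ (2 * (‖x‖ + 1)) := hK.pos _ (by positivity)
    have h2 := setIntegral_ball_pos (continuous_rpow_comp hcu hp.le)
      (fun y => Real.rpow_nonneg (hpos y) p) hxR (Real.rpow_pos_of_pos hux p)
    have h3 := Real.rpow_pos_of_pos hux q
    positivity
  have h1 := nonpos_of_increment_le (F := fun R : ℝ => ∫ x in ball (0 : 𝔼 N) R, negLapPow m u x)
    (U := fun R : ℝ => ∫ x in ball (0 : 𝔼 N) R, u x) (n := 2 * m) (s := p + q) (by omega) hpq hc hC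
    hmono (by simp) (by simp) hFU hinc (R₁ := ‖x‖ + 1) (by positivity)
  exact absurd (setIntegral_ball_pos hcf hf hxR hfx) (not_lt.2 h1)
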